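/- arXiv:1812.11616 — 3 statements merged into one kernel-verified Lean document; each statement's English description precedes it below -/
import Mathlib

section
/- Let n ≥ 2 and 2 ≤ p < ∞. For every s < s̄_p = (n−1)(1/2 − 1/p) there is no constant C such that ‖⟨D⟩^{−s} e^{i√(−Δ)} f‖_{L^p(ℝⁿ)} ≤ C‖f‖_{L^p(ℝⁿ)} holds for all f in the Schwartz class S(ℝⁿ); that is, the fixed-time regularity exponent s̄_p for the half-wave propagator at time t = 1 cannot be replaced by any smaller exponent. -/
open MeasureTheory
open scoped RealInnerProductSpace ENNReal

noncomputable section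

/-- `ℝⁿ` as a euclidean space. -/
abbrev V (n : ℕ) := EuclideanSpace ℝ (Fin n)

/-- The Fourier transform `f̂(ξ) = ∫_{ℝⁿ} e^{−i⟨y,ξ⟩} f(y) dy`. -/
def FT {n : ℕ} (f : V n → ℂ) (ξ : V n) : ℂ :=
  ∫ y : V n, Complex.exp (-(Complex.I * ((⟪y, ξ⟫ : ℝ) : ℂ))) * f y

/-- The Bessel potential `⟨D⟩^s g (x) = (2π)^{−n} ∫ e^{i⟨x,ξ⟩}(1+|ξ|²)^{s/2} ĝ(ξ) dξ`. -/
def besselD {n : ℕ} (s : ℝ) (g : V n → ℂ) (x : V n) : ℂ :=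
  ((((2 * Real.pi) ^ n)⁻¹ : ℝ) : ℂ) *
    ∫ ξ : V n, Complex.exp (Complex.I * ((⟪x, ξ⟫ : ℝ) : ℂ)) *
      (((1 + ‖ξ‖ ^ 2) ^ (s / 2) : ℝ) : ℂ) * FT g ξ

/-- The half-wave propagator
`e^{it√(−Δ)}f(x) = (2π)^{−n} ∫ e^{i(⟨x,ξ⟩+t|ξ|)} f̂(ξ) dξ`. -/
def halfWave {n : ℕ} (t : ℝ) (f : V n → ℂ) (x : V n) : ℂ :=
  ((((2 * Real.pi) ^ n)⁻¹ : ℝ) : ℂ) *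
    ∫ ξ : V n, Complex.exp (Complex.I * (((⟪x, ξ⟫ + t * ‖ξ‖ : ℝ)) : ℂ)) * FT f ξ

lemma integrableOn_integral_glasser {a : ℂ} (ha : 0 < a.re) {r : ℝ} (hr : 0 < r) :
    IntegrableOn (fun t : ℝ => Complex.exp (-a * ((t - r / t : ℝ) : ℂ) ^ 2)) (Set.Ioi 0) ∧
    ∫ t in Set.Ioi (0 : ℝ), Complex.exp (-a * ((t - r / t : ℝ) : ℂ) ^ 2) =
      (Real.pi / a) ^ (1 / 2 : ℂ) / 2 := by
  set F : ℝ → ℂ := fun t => Complex.exp (-a * ((t - r / t : ℝ) : ℂ) ^ 2) with hF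
  have hd : ∀ t ∈ Set.Ioi (0 : ℝ),
      HasDerivWithinAt (fun t : ℝ => t - r / t) (1 + r / t ^ 2) (Set.Ioi 0) t := by
    intro t ht
    have ht' : t ≠ 0 := ne_of_gt ht
    have h := (hasDerivAt_id t).sub ((hasDerivAt_inv ht').const_mul r)
    refine (h.congr_deriv ?_).hasDerivWithinAt
    field_simp
    ring
  have hinj : Set.InjOn (fun t : ℝ => t - r / t) (Set.Ioi 0) := by
    apply StrictMonoOn.injOn
    intro x hx y hy hxy
    have : r / y < r / x := div_lt_div_of_pos_left hr hx hxy
    simp only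
    linarith
  have himg : (fun t : ℝ => t - r / t) '' Set.Ioi 0 = Set.univ := by
    refine Set.eq_univ_of_forall fun y => ?_
    have hs : Real.sqrt (y ^ 2 + 4 * r) ^ 2 = y ^ 2 + 4 * r := Real.sq_sqrt (by positivity)
    have hlt : |y| < Real.sqrt (y ^ 2 + 4 * r) := by
      apply Real.lt_sqrt_of_sq_lt
      rw [sq_abs]
      linarith
    have hpos : 0 < (y + Real.sqrt (y ^ 2 + 4 * r)) / 2 := by
      have := neg_abs_le y
      linarith
    refine ⟨_, hpos, ?_⟩
    simp only
    generalize Real.sqrt (y ^ 2 + 4 * r) = w at hs hpos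
    have : y + w ≠ 0 := by linarith
    field_simp
    linarith
  have hdi : ∀ t ∈ Set.Ioi (0 : ℝ),
      HasDerivWithinAt (fun t : ℝ => r / t) (-(r / t ^ 2)) (Set.Ioi 0) t := by
    intro t ht
    have ht' : t ≠ 0 := ne_of_gt ht
    refine (((hasDerivAt_inv ht').const_mul r).congr_deriv ?_).hasDerivWithinAt
    field_simp
  have hinji : Set.InjOn (fun t : ℝ => r / t) (Set.Ioi 0) := by
    intro x hx y hy hxy
    have hx' : x ≠ 0 := ne_of_gt hx
    have hy' : y ≠ 0 := ne_of_gt hy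
    simp only at hxy
    field_simp at hxy
    exact hxy.symm
  have himgi : (fun t : ℝ => r / t) '' Set.Ioi 0 = Set.Ioi 0 := by
    ext y
    constructor
    · rintro ⟨t, ht, rfl⟩
      exact div_pos hr ht
    · intro hy
      exact ⟨r / y, div_pos hr hy, by field_simp⟩
  have hG := integrable_cexp_neg_mul_sq ha
  have h1 : IntegrableOn (fun t : ℝ => |1 + r / t ^ 2| • F t) (Set.Ioi 0) := by
    rw [← integrableOn_image_iff_integrableOn_abs_deriv_smul measurableSet_Ioi hd hinj
      (fun y : ℝ => Complex.exp (-a * (y : ℂ) ^ 2)), himg]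
    exact hG.integrableOn
  have h1' : ∫ t in Set.Ioi (0 : ℝ), |1 + r / t ^ 2| • F t = (Real.pi / a) ^ (1 / 2 : ℂ) := by
    have := integral_image_eq_integral_abs_deriv_smul measurableSet_Ioi hd hinj
      (fun y : ℝ => Complex.exp (-a * (y : ℂ) ^ 2))
    rw [himg, setIntegral_univ, integral_gaussian_complex ha] at this
    exact this.symm
  have hFm : Measurable F := by
    rw [hF]; fun_prop
  have hFi : IntegrableOn F (Set.Ioi 0) := by
    refine Integrable.mono h1 hFm.aestronglyMeasurable (Filter.Eventually.of_forall fun t => ?_)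
    have : 0 ≤ r / t ^ 2 := by positivity
    rw [norm_smul, Real.norm_eq_abs, abs_abs, abs_of_nonneg (by linarith)]
    nlinarith [norm_nonneg (F t)]
  have hsym : ∀ t ∈ Set.Ioi (0 : ℝ), F (r / t) = F t := by
    intro t ht
    have ht' : t ≠ 0 := ne_of_gt ht
    have : r / t - r / (r / t) = -(t - r / t) := by field_simp; ring
    simp only [hF, this]
    push_cast
    ring_nf
  have h2 : ∫ t in Set.Ioi (0 : ℝ), F t = ∫ t in Set.Ioi (0 : ℝ), (r / t ^ 2) • F t := by
    conv_lhs => rw [← himgi]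
    rw [integral_image_eq_integral_abs_deriv_smul measurableSet_Ioi hdi hinji]
    refine setIntegral_congr_fun measurableSet_Ioi fun t ht => ?_
    rw [hsym t ht, abs_neg, abs_of_nonneg (by positivity)]
  have h3 : ∀ t, |1 + r / t ^ 2| • F t = F t + (r / t ^ 2) • F t := by
    intro t
    rw [abs_of_nonneg (by positivity), add_smul, one_smul]
  refine ⟨hFi, ?_⟩
  have h4 : IntegrableOn (fun t : ℝ => (r / t ^ 2) • F t) (Set.Ioi 0) := by
    refine (h1.sub hFi).congr (Filter.Eventually.of_forall fun t => ?_)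
    simp [h3]
  simp_rw [h3] at h1'
  rw [integral_add hFi h4, ← h2] at h1'
  rw [← h1']
  ring

/-- Subordination of the exponential to Gaussians, valid for complex times. -/
lemma integral_subordination {z : ℂ} (hz : 0 < z.re) {r : ℝ} (hr : 0 < r) :
    ∫ t in Set.Ioi (0 : ℝ),
        Complex.exp (-(z / 2) * (t : ℂ) ^ 2) * Complex.exp (-(z / (2 * (t : ℂ) ^ 2)) * (r : ℂ) ^ 2) =
      (Real.pi / (z / 2)) ^ (1 / 2 : ℂ) / 2 * Complex.exp (-z * r) := by
  have hz2 : 0 < (z / 2).re := by simpa using hz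
  rw [← (integrableOn_integral_glasser hz2 hr).2, ← integral_mul_const]
  refine setIntegral_congr_fun measurableSet_Ioi fun t ht => ?_
  have ht' : (t : ℂ) ≠ 0 := by exact_mod_cast ne_of_gt ht
  rw [← Complex.exp_add, ← Complex.exp_add]
  congr 1
  push_cast
  field_simp
  ring

lemma norm_integral_gaussian_le {n : ℕ} {b : ℂ} (hb : 0 < b.re) (w : V n) :
    ‖∫ ξ : V n, Complex.exp (-b * (‖ξ‖ : ℂ) ^ 2 + Complex.I * ((⟪w, ξ⟫ : ℝ) : ℂ))‖ ≤
      (Real.pi / ‖b‖) ^ ((n : ℝ) / 2) := by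
  rw [GaussianFourier.integral_cexp_neg_mul_sq_norm_add hb, norm_mul]
  have h1 : ‖(Real.pi / b : ℂ) ^ (Module.finrank ℝ (V n) / 2 : ℂ)‖ =
      (Real.pi / ‖b‖) ^ ((n : ℝ) / 2) := by
    have : (Module.finrank ℝ (V n) / 2 : ℂ) = (((n : ℝ) / 2 : ℝ) : ℂ) := by simp
    rw [this, Complex.norm_cpow_real, norm_div, Complex.norm_real, Real.norm_eq_abs,
      abs_of_pos Real.pi_pos]
  have h2 : ‖Complex.exp (Complex.I ^ 2 * (‖w‖ : ℂ) ^ 2 / (4 * b))‖ ≤ 1 := by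
    rw [Complex.norm_exp]
    apply Real.exp_le_one_iff.2
    have : Complex.I ^ 2 * (‖w‖ : ℂ) ^ 2 / (4 * b) = ((-(‖w‖ ^ 2 / 4) : ℝ) : ℂ) * b⁻¹ := by
      push_cast
      rw [Complex.I_sq]
      field_simp
    rw [this, Complex.re_ofReal_mul, Complex.inv_re]
    have : 0 ≤ b.re / Complex.normSq b := div_nonneg hb.le (Complex.normSq_nonneg _)
    nlinarith [sq_nonneg ‖w‖]
  rw [h1]
  exact mul_le_of_le_one_right (by positivity) h2

open scoped FourierTransform ContDiff in
/-- A test function is the Fourier transform of the Schwartz function given by Fourier inversion. -/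
lemma exists_schwartz_FT_eq {n : ℕ} {h : V n → ℂ} (hc : HasCompactSupport h)
    (hs : ContDiff ℝ ∞ h) :
    ∃ f : SchwartzMap (V n) ℂ,
      (∀ x, f x = ((((2 * Real.pi) ^ n)⁻¹ : ℝ) : ℂ) *
        ∫ ξ : V n, Complex.exp (Complex.I * ((⟪x, ξ⟫ : ℝ) : ℂ)) * h ξ) ∧
      (∀ ξ, FT f ξ = h ξ) ∧
      ∫ x, ‖f x‖ ^ 2 = ((2 * Real.pi) ^ n)⁻¹ * ∫ ξ, ‖h ξ‖ ^ 2 := by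
  have hpi : (2 * Real.pi) ≠ 0 := by positivity
  have hc' : HasCompactSupport fun x : V n => h ((2 * Real.pi) • x) :=
    hc.comp_homeomorph (Homeomorph.smulOfNeZero (2 * Real.pi) hpi)
  have hs' : ContDiff ℝ ∞ fun x : V n => h ((2 * Real.pi) • x) := by fun_prop
  set H : SchwartzMap (V n) ℂ := hc'.toSchwartzMap hs' with hH
  have hHa : ∀ x, H x = h ((2 * Real.pi) • x) := fun x => rfl
  refine ⟨𝓕⁻ H, fun x => ?_, fun ξ => ?_, ?_⟩
  · have := Measure.integral_comp_smul_of_nonneg (volume : Measure (V n))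
      (fun ξ : V n => Complex.exp (Complex.I * ((⟪x, ξ⟫ : ℝ) : ℂ)) * h ξ) (2 * Real.pi)
      (hR := by positivity)
    rw [finrank_euclideanSpace_fin, Complex.real_smul] at this
    rw [← this, SchwartzMap.fourierInv_coe, Real.fourierInv_eq']
    congr 1
    ext v
    rw [smul_eq_mul, hHa, real_inner_smul_right, real_inner_comm]
    congr 2
    push_cast
    ring
  · have h1 : FT (𝓕⁻ H : SchwartzMap (V n) ℂ) ξ =
        (𝓕 (𝓕⁻ H : SchwartzMap (V n) ℂ)) ((2 * Real.pi)⁻¹ • ξ) := by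
      rw [SchwartzMap.fourier_coe, Real.fourier_eq', FT]
      congr 1
      ext v
      rw [smul_eq_mul, real_inner_smul_right]
      congr 2
      push_cast
      have : (Real.pi : ℂ) ≠ 0 := by exact_mod_cast Real.pi_ne_zero
      field_simp
    rw [h1, FourierTransform.fourier_fourierInv_eq, hHa, smul_smul, mul_inv_cancel₀ hpi, one_smul]
  · rw [← SchwartzMap.integral_norm_sq_fourier, FourierTransform.fourier_fourierInv_eq]
    simp_rw [hHa]
    rw [Measure.integral_comp_smul_of_nonneg (volume : Measure (V n)) (fun ξ : V n => ‖h ξ‖ ^ 2)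
      (2 * Real.pi) (hR := by positivity), finrank_euclideanSpace_fin, smul_eq_mul]

lemma norm_integral_gaussian_mul_FT_le {n : ℕ} (θ : SchwartzMap (V n) ℂ) {b : ℂ} (hb : 0 < b.re)
    (ε : ℝ) (x : V n) :
    ‖∫ ξ : V n, Complex.exp (Complex.I * ((⟪x, ξ⟫ : ℝ) : ℂ)) * FT θ (ε • ξ) *
        Complex.exp (-b * (‖ξ‖ : ℂ) ^ 2)‖ ≤ (∫ y, ‖θ y‖) * (Real.pi / ‖b‖) ^ ((n : ℝ) / 2) := by
  set K : V n → V n → ℂ := fun w ξ =>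
    Complex.exp (-b * (‖ξ‖ : ℂ) ^ 2 + Complex.I * ((⟪w, ξ⟫ : ℝ) : ℂ)) with hK
  have hKn : ∀ w ξ, ‖K w ξ‖ = Real.exp (-b.re * ‖ξ‖ ^ 2) := by
    intro w ξ
    rw [hK, Complex.norm_exp]
    congr 1
    rw [Complex.add_re, Complex.I_mul_re, Complex.ofReal_im, ← Complex.ofReal_pow,
      Complex.re_mul_ofReal, Complex.neg_re]
    ring
  have hgi : Integrable fun ξ : V n => Real.exp (-b.re * ‖ξ‖ ^ 2) := by
    have := (GaussianFourier.integrable_cexp_neg_mul_sq_norm_add hb Complex.I (0 : V n)).norm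
    refine this.congr (Filter.Eventually.of_forall fun ξ => ?_)
    exact hKn 0 ξ
  have hint : Integrable (Function.uncurry fun (ξ y : V n) => K (x - ε • y) ξ * θ y)
      ((volume : Measure (V n)).prod volume) := by
    have hθ : Continuous θ := θ.continuous
    refine (hgi.mul_prod θ.integrable.norm).mono' ?_ (Filter.Eventually.of_forall fun q => ?_)
    · apply Continuous.aestronglyMeasurable
      simp only [hK, Function.uncurry_def]
      fun_prop
    · rw [Function.uncurry_def, norm_mul, hKn]
  have hrw : ∀ ξ : V n, Complex.exp (Complex.I * ((⟪x, ξ⟫ : ℝ) : ℂ)) * FT θ (ε • ξ) *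
      Complex.exp (-b * (‖ξ‖ : ℂ) ^ 2) = ∫ y, K (x - ε • y) ξ * θ y := by
    intro ξ
    rw [mul_right_comm, FT, ← integral_const_mul]
    congr 1
    ext y
    rw [← mul_assoc, ← Complex.exp_add, ← Complex.exp_add, hK]
    simp only [inner_sub_left, real_inner_smul_left, real_inner_smul_right]
    congr 2
    push_cast
    ring
  simp_rw [hrw]
  rw [integral_integral_swap hint, ← integral_mul_const]
  refine norm_integral_le_of_norm_le (θ.integrable.norm.mul_const _)
    (Filter.Eventually.of_forall fun y => ?_)
  rw [integral_mul_const, norm_mul, mul_comm]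
  gcongr
  exact norm_integral_gaussian_le hb _

/-- The dispersive estimate for the half-wave kernel at unit time, at frequency scale `ε⁻¹`. -/
lemma exists_norm_integral_exp_neg_norm_le {n : ℕ} (θ : SchwartzMap (V n) ℂ) {ψ : V n → ℂ}
    (hψ : ∀ ξ, FT θ ξ = ψ ξ) (hψc : Continuous ψ) (hψs : HasCompactSupport ψ) (hψ0 : ψ 0 = 0) :
    ∃ C : ℝ, 0 ≤ C ∧ ∀ ε : ℝ, 0 < ε → ε ≤ 1 → ∀ x : V n,
      ‖∫ ξ : V n, Complex.exp (Complex.I * ((⟪x, ξ⟫ : ℝ) : ℂ)) *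
        (Complex.exp (-(ε + Complex.I) * ‖ξ‖) * ψ (ε • ξ))‖ ≤ C * ε ^ (-((n : ℝ) + 1) / 2) := by
  set M := ∫ y, ‖θ y‖ with hM
  have hM0 : 0 ≤ M := integral_nonneg fun _ => norm_nonneg _
  have hG : 0 < Real.Gamma (((n : ℝ) + 1) / 2) := Real.Gamma_pos_of_pos (by positivity)
  refine ⟨2 * (M * (2 * Real.pi) ^ ((n : ℝ) / 2) *
    ((1 / 2) ^ (-((n : ℝ) + 1) / 2) * (1 / 2) * Real.Gamma (((n : ℝ) + 1) / 2))),
    by positivity, ?_⟩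
  intro ε hε hε1 x
  set z : ℂ := ε + Complex.I with hz
  have hzre : z.re = ε := by simp [hz]
  have hzim : z.im = 1 := by simp [hz]
  have hz1 : 1 ≤ ‖z‖ := by
    have := Complex.abs_im_le_norm z
    rwa [hzim, abs_one] at this
  have hz2 : ‖z‖ ≤ 2 := by
    have := Complex.norm_le_abs_re_add_abs_im z
    rw [hzim, hzre, abs_one, abs_of_pos hε] at this
    linarith
  have hz0 : 0 < z.re := by rw [hzre]; exact hε
  set κ : ℂ := (Real.pi / (z / 2)) ^ (1 / 2 : ℂ) / 2 with hκ
  have hκn : 1 / 2 ≤ ‖κ‖ := by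
    have h12 : (1 / 2 : ℂ) = ((1 / 2 : ℝ) : ℂ) := by push_cast; rfl
    rw [hκ, norm_div, h12, Complex.norm_cpow_real, norm_div, norm_div, Complex.norm_real,
      Real.norm_eq_abs, abs_of_pos Real.pi_pos, Complex.norm_two]
    have : (1 : ℝ) ≤ (Real.pi / (‖z‖ / 2)) ^ (1 / 2 : ℝ) := by
      apply Real.one_le_rpow _ (by norm_num)
      rw [le_div_iff₀ (by positivity)]
      have := Real.pi_gt_three
      linarith
    linarith
  set A : V n → ℂ := fun ξ => Complex.exp (Complex.I * ((⟪x, ξ⟫ : ℝ) : ℂ)) * ψ (ε • ξ) with hA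
  set B : V n → ℝ → ℂ := fun ξ t => Complex.exp (-(z / 2) * (t : ℂ) ^ 2) *
    Complex.exp (-(z / (2 * (t : ℂ) ^ 2)) * (‖ξ‖ : ℂ) ^ 2) with hB
  have hAc : Continuous A := by simp only [hA]; fun_prop
  have hAs : HasCompactSupport A :=
    (hψs.comp_homeomorph (Homeomorph.smulOfNeZero ε hε.ne')).mul_left
  have hsub : ∀ ξ, κ * (Complex.exp (Complex.I * ((⟪x, ξ⟫ : ℝ) : ℂ)) *
      (Complex.exp (-z * ‖ξ‖) * ψ (ε • ξ))) = ∫ t in Set.Ioi (0 : ℝ), A ξ * B ξ t := by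
    intro ξ
    rcases eq_or_ne ξ 0 with rfl | hξ
    · simp [hA, hψ0]
    · rw [integral_const_mul, integral_subordination hz0 (norm_pos_iff.2 hξ)]
      simp only [hA]
      ring
  have hBn : ∀ ξ t, ‖B ξ t‖ ≤ Real.exp (-(ε / 2) * t ^ 2) := by
    intro ξ t
    have h1 : -(z / 2) * (t : ℂ) ^ 2 = z * ((-(t ^ 2 / 2) : ℝ) : ℂ) := by push_cast; ring
    have h2 : -(z / (2 * (t : ℂ) ^ 2)) * (‖ξ‖ : ℂ) ^ 2 =
        z * ((-(‖ξ‖ ^ 2 / (2 * t ^ 2)) : ℝ) : ℂ) := by push_cast; ring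
    simp only [hB]
    rw [← Complex.exp_add, Complex.norm_exp, h1, h2, Complex.add_re, Complex.re_mul_ofReal,
      Complex.re_mul_ofReal, hzre]
    apply Real.exp_le_exp.2
    have : 0 ≤ ε * (‖ξ‖ ^ 2 / (2 * t ^ 2)) := by positivity
    linarith
  have hint : Integrable (Function.uncurry fun (ξ : V n) (t : ℝ) => A ξ * B ξ t)
      ((volume : Measure (V n)).prod (volume.restrict (Set.Ioi (0 : ℝ)))) := by
    have hgi := (integrable_exp_neg_mul_sq (half_pos hε)).restrict (s := Set.Ioi (0 : ℝ))
    refine ((hAc.integrable_of_hasCompactSupport hAs).norm.mul_prod hgi).mono' ?_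
      (Filter.Eventually.of_forall fun q => ?_)
    · apply Measurable.aestronglyMeasurable
      have := hAc.measurable
      simp only [Function.uncurry_def, hB]
      fun_prop
    · rw [Function.uncurry_def, norm_mul]
      gcongr
      exact hBn _ _
  have hinner : ∀ t ∈ Set.Ioi (0 : ℝ), ‖∫ ξ, A ξ * B ξ t‖ ≤
      M * (2 * Real.pi) ^ ((n : ℝ) / 2) * (t ^ (n : ℝ) * Real.exp (-(ε / 2) * t ^ (2 : ℝ))) := by
    intro t ht
    have ht0 : 0 < t := ht
    set b : ℂ := z / (2 * (t : ℂ) ^ 2) with hb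
    have hb' : b = z * (((2 * t ^ 2)⁻¹ : ℝ) : ℂ) := by rw [hb]; push_cast; ring
    have hbre : 0 < b.re := by
      rw [hb', Complex.re_mul_ofReal]; positivity
    have hbn : Real.pi / ‖b‖ ≤ 2 * Real.pi * t ^ 2 := by
      rw [hb', norm_mul, Complex.norm_real, Real.norm_eq_abs, abs_of_pos (by positivity)]
      rw [div_le_iff₀ (by positivity)]
      have : 2 * Real.pi * t ^ 2 * (‖z‖ * (2 * t ^ 2)⁻¹) = Real.pi * ‖z‖ := by
        field_simp
      rw [this]
      exact le_mul_of_one_le_right Real.pi_pos.le hz1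
    have hrw : ∀ ξ, A ξ * B ξ t = Complex.exp (-(z / 2) * (t : ℂ) ^ 2) *
        (Complex.exp (Complex.I * ((⟪x, ξ⟫ : ℝ) : ℂ)) * FT θ (ε • ξ) *
          Complex.exp (-b * (‖ξ‖ : ℂ) ^ 2)) := by
      intro ξ
      rw [hψ]
      simp only [hA, hB]
      ring
    simp_rw [hrw]
    rw [integral_const_mul, norm_mul, norm_cexp_neg_mul_sq]
    have h2 : (z / 2).re = ε / 2 := by simp [hzre]
    rw [h2, Real.rpow_two]
    have h3 := norm_integral_gaussian_mul_FT_le θ hbre ε x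
    have h4 : (Real.pi / ‖b‖) ^ ((n : ℝ) / 2) ≤ (2 * Real.pi) ^ ((n : ℝ) / 2) * t ^ (n : ℝ) := by
      calc (Real.pi / ‖b‖) ^ ((n : ℝ) / 2) ≤ (2 * Real.pi * t ^ 2) ^ ((n : ℝ) / 2) := by gcongr
        _ = (2 * Real.pi) ^ ((n : ℝ) / 2) * t ^ (n : ℝ) := by
          rw [Real.mul_rpow (by positivity) (by positivity), ← Real.rpow_two,
            ← Real.rpow_mul ht0.le]
          congr 2
          ring
    calc _ ≤ Real.exp (-(ε / 2) * t ^ 2) *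
          (M * ((2 * Real.pi) ^ ((n : ℝ) / 2) * t ^ (n : ℝ))) := by
          gcongr
          exact h3.trans (by gcongr)
      _ = _ := by ring
  have hmain : ‖κ‖ * ‖∫ ξ : V n, Complex.exp (Complex.I * ((⟪x, ξ⟫ : ℝ) : ℂ)) *
        (Complex.exp (-z * ‖ξ‖) * ψ (ε • ξ))‖ ≤ M * (2 * Real.pi) ^ ((n : ℝ) / 2) *
      ((ε / 2) ^ (-((n : ℝ) + 1) / 2) * (1 / 2) * Real.Gamma (((n : ℝ) + 1) / 2)) := by
    have hn1 : (-1 : ℝ) < n := by linarith [(Nat.cast_nonneg n : (0 : ℝ) ≤ n)]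
    rw [← norm_mul, ← integral_const_mul, ← integral_rpow_mul_exp_neg_mul_rpow two_pos hn1
      (half_pos hε), ← integral_const_mul]
    simp_rw [hsub]
    rw [integral_integral_swap hint]
    refine norm_integral_le_of_norm_le ?_ ?_
    · exact (integrableOn_rpow_mul_exp_neg_mul_rpow hn1 two_pos (half_pos hε)).const_mul _
    · exact (ae_restrict_iff' measurableSet_Ioi).2 (Filter.Eventually.of_forall hinner)
  have hsplit : (ε / 2) ^ (-((n : ℝ) + 1) / 2) =
      (1 / 2) ^ (-((n : ℝ) + 1) / 2) * ε ^ (-((n : ℝ) + 1) / 2) := by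
    rw [← Real.mul_rpow (by norm_num) hε.le]
    congr 1
    ring
  rw [hsplit] at hmain
  have h5 := mul_le_mul_of_nonneg_right hκn (norm_nonneg
    (∫ ξ : V n, Complex.exp (Complex.I * ((⟪x, ξ⟫ : ℝ) : ℂ)) *
        (Complex.exp (-z * ‖ξ‖) * ψ (ε • ξ))))
  linarith

open scoped ContDiff Topology in
lemma contDiff_exp_norm_mul {n : ℕ} {φ : V n → ℂ} (hφ : ContDiff ℝ ∞ φ) (hφ0 : φ =ᶠ[𝓝 0] 0)
    (c : ℂ) : ContDiff ℝ ∞ fun ξ => Complex.exp (c * (‖ξ‖ : ℂ)) * φ ξ := by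
  rw [contDiff_iff_contDiffAt]
  intro ξ
  rcases eq_or_ne ξ 0 with rfl | hξ
  · refine (contDiffAt_const (c := (0 : ℂ))).congr_of_eventuallyEq ?_
    filter_upwards [hφ0] with ξ h
    rw [h, Pi.zero_apply, mul_zero]
  · have h1 : ContDiffAt ℝ ∞ (fun ξ : V n => (‖ξ‖ : ℂ)) ξ :=
      Complex.ofRealCLM.contDiff.contDiffAt.comp ξ (contDiffAt_norm ℝ hξ)
    exact (contDiffAt_const.mul h1).cexp.mul hφ.contDiffAt

lemma ten_rpow_neg_abs_le {u a : ℝ} (h1 : 1 ≤ u) (h10 : u ≤ 10) : (10 : ℝ) ^ (-|a|) ≤ u ^ a :=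
  (Real.rpow_le_rpow_of_nonpos (by linarith) h10 (by simp)).trans
    (Real.rpow_le_rpow_of_exponent_le h1 (neg_abs_le a))

lemma le_one_add_sq_rpow {ε r s : ℝ} (hε : 0 < ε) (hε1 : ε ≤ 1) (h1 : 1 ≤ ε * r)
    (h3 : ε * r ≤ 3) : 10 ^ (-|s / 2|) * ε ^ s ≤ (1 + r ^ 2) ^ (-s / 2) := by
  have hu : (1 + r ^ 2) ^ (-s / 2) = (ε ^ 2 * (1 + r ^ 2)) ^ (-s / 2) * ε ^ s := by
    rw [Real.mul_rpow (by positivity) (by positivity), ← Real.rpow_two ε, ← Real.rpow_mul hε.le,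
      mul_right_comm, ← Real.rpow_add hε]
    ring_nf
    simp
  rw [hu]
  gcongr
  have : |s / 2| = |-s / 2| := by rw [neg_div, abs_neg]
  rw [this]
  apply ten_rpow_neg_abs_le <;> nlinarith

open scoped ContDiff Topology in
/-- Data which the half-wave propagator focuses at the origin at unit time. -/
lemma exists_focusing_data {n : ℕ} (hn : 0 < n) (s : ℝ) :
    ∃ C c : ℝ, 0 ≤ C ∧ 0 < c ∧ ∀ ε : ℝ, 0 < ε → ε ≤ 1 → ∃ f : SchwartzMap (V n) ℂ,
      (∀ x, ‖f x‖ ≤ C * ε ^ (-((n : ℝ) + 1) / 2)) ∧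
      (∫ x, ‖f x‖ ^ 2 ≤ C * ε ^ (-(n : ℝ))) ∧
      ∀ x, ‖x‖ ≤ ε / 3 → c * ε ^ (s - n) ≤ ‖besselD (-s) (halfWave 1 f) x‖ := by
  set v : V n := EuclideanSpace.single ⟨0, hn⟩ 2 with hv
  have hvn : ‖v‖ = 2 := by simp [hv]
  let Ψ : ContDiffBump v := ⟨1 / 2, 1, by norm_num, by norm_num⟩
  have hsupp : ∀ ξ, Ψ ξ ≠ 0 → 1 ≤ ‖ξ‖ ∧ ‖ξ‖ ≤ 3 := by
    intro ξ hξ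
    have h1 : ξ ∈ Metric.ball v 1 := by
      have := Ψ.support_eq
      rw [show Metric.ball v 1 = Function.support Ψ from this.symm]
      exact hξ
    rw [mem_ball_iff_norm] at h1
    have h2 := abs_le.1 (abs_norm_sub_norm_le ξ v)
    constructor <;> linarith [h2.1, h2.2]
  set φ : V n → ℂ := fun ξ => (Ψ ξ : ℂ) with hφ
  have hφs : ContDiff ℝ ∞ φ := Complex.ofRealCLM.contDiff.comp Ψ.contDiff
  have hφc : HasCompactSupport φ := Ψ.hasCompactSupport.comp_left (g := fun r : ℝ => (r : ℂ)) rfl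
  have hφ0 : φ =ᶠ[𝓝 0] 0 := by
    filter_upwards [Metric.ball_mem_nhds (0 : V n) one_pos] with ξ hξ
    rw [mem_ball_zero_iff] at hξ
    have : Ψ ξ = 0 := by
      by_contra h
      linarith [(hsupp ξ h).1]
    simp [hφ, this]
  set ψ : V n → ℂ := fun ξ => Complex.exp (1 * (‖ξ‖ : ℂ)) * φ ξ with hψ
  have hψs : ContDiff ℝ ∞ ψ := contDiff_exp_norm_mul hφs hφ0 1
  have hψc : HasCompactSupport ψ := hφc.mul_left
  have hψ0 : ψ 0 = 0 := by
    have := hφ0.self_of_nhds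
    simp only [Pi.zero_apply] at this
    simp [hψ, this]
  obtain ⟨θ, -, hθ, -⟩ := exists_schwartz_FT_eq hψc hψs
  obtain ⟨C, hC0, hC⟩ := exists_norm_integral_exp_neg_norm_le θ hθ hψs.continuous hψc hψ0
  have hP : (0 : ℝ) < ((2 * Real.pi) ^ n)⁻¹ := by positivity
  set P : ℝ := ((2 * Real.pi) ^ n)⁻¹ with hPdef
  have hI2 : 0 ≤ ∫ ξ, Ψ ξ ^ 2 := integral_nonneg fun _ => sq_nonneg _
  have hI : 0 < ∫ ξ, Ψ ξ := Ψ.integral_pos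
  have h10 : (0 : ℝ) < 10 ^ (-|s / 2|) := by positivity
  refine ⟨P * C + P * ∫ ξ, Ψ ξ ^ 2, P * (1 / 2 * 10 ^ (-|s / 2|) * ∫ ξ, Ψ ξ),
    by positivity, by positivity, ?_⟩
  intro ε hε hε1
  have hscale : ∀ u : V n → ℝ, ∫ ξ, u (ε • ξ) = ε ^ (-(n : ℝ)) * ∫ ξ, u ξ := by
    intro u
    rw [Measure.integral_comp_smul_of_nonneg (volume : Measure (V n)) u ε (hR := hε.le),
      finrank_euclideanSpace_fin, smul_eq_mul, Real.rpow_neg hε.le, Real.rpow_natCast]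
  set φε : V n → ℂ := fun ξ => φ (ε • ξ) with hφε
  have hφεs : ContDiff ℝ ∞ φε := by
    simp only [hφε]
    fun_prop
  have hφεc : HasCompactSupport φε := hφc.comp_homeomorph (Homeomorph.smulOfNeZero ε hε.ne')
  have hφε0 : φε =ᶠ[𝓝 0] 0 := by
    have ht : Filter.Tendsto (fun ξ : V n => ε • ξ) (𝓝 0) (𝓝 0) := by
      have : Continuous fun ξ : V n => ε • ξ := by fun_prop
      simpa using this.tendsto 0
    exact ht.eventually hφ0
  obtain ⟨f, hf, hFf, hf2⟩ := exists_schwartz_FT_eq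
    (h := fun ξ => Complex.exp (-Complex.I * (‖ξ‖ : ℂ)) * φε ξ) (hφεc.mul_left)
    (contDiff_exp_norm_mul hφεs hφε0 (-Complex.I))
  obtain ⟨g, hg, hFg, -⟩ := exists_schwartz_FT_eq hφεc hφεs
  have hfg : halfWave 1 f = g := by
    ext x
    rw [halfWave, hg]
    congr 2
    ext ξ
    rw [hFf, ← mul_assoc, ← Complex.exp_add]
    congr 2
    push_cast
    ring
  have hr : 0 ≤ ε ^ (-((n : ℝ) + 1) / 2) := by positivity
  have hr' : 0 ≤ ε ^ (-(n : ℝ)) := by positivity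
  refine ⟨f, fun x => ?_, ?_, fun x hx => ?_⟩
  · rw [hf, norm_mul, Complex.norm_real, Real.norm_eq_abs, abs_of_pos hP]
    have h1 : ∀ ξ : V n, Complex.exp (-Complex.I * (‖ξ‖ : ℂ)) * φε ξ =
        Complex.exp (-(ε + Complex.I) * ‖ξ‖) * ψ (ε • ξ) := by
      intro ξ
      simp only [hψ, hφε]
      rw [← mul_assoc, ← Complex.exp_add, norm_smul, Real.norm_eq_abs, abs_of_pos hε]
      congr 2
      push_cast
      ring
    simp_rw [h1]
    calc _ ≤ P * (C * ε ^ (-((n : ℝ) + 1) / 2)) := by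
          gcongr
          exact hC ε hε hε1 x
      _ ≤ _ := by
          have : 0 ≤ P * ∫ ξ, Ψ ξ ^ 2 := by positivity
          nlinarith
  · have h1 : ∀ ξ : V n, ‖Complex.exp (-Complex.I * (‖ξ‖ : ℂ)) * φε ξ‖ ^ 2 = Ψ (ε • ξ) ^ 2 := by
      intro ξ
      have : ‖Complex.exp (-Complex.I * (‖ξ‖ : ℂ))‖ = 1 := by
        rw [Complex.norm_exp]; simp
      rw [norm_mul, this, one_mul]
      simp [hφε, hφ]
    rw [hf2]
    simp_rw [h1]
    rw [hscale (fun ξ => Ψ ξ ^ 2)]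
    have : 0 ≤ P * C := by positivity
    nlinarith
  · rw [hfg, besselD, norm_mul, Complex.norm_real, Real.norm_eq_abs, abs_of_pos hP, mul_assoc]
    gcongr
    simp_rw [hFg]
    set w : V n → ℂ := fun ξ => Complex.exp (Complex.I * ((⟪x, ξ⟫ : ℝ) : ℂ)) *
      (((1 + ‖ξ‖ ^ 2) ^ (-s / 2) : ℝ) : ℂ) * φε ξ with hw
    have hwi : Integrable w := by
      refine Continuous.integrable_of_hasCompactSupport ?_ hφεc.mul_left
      have h1 : Continuous fun ξ : V n => (1 + ‖ξ‖ ^ 2) ^ (-s / 2) :=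
        Continuous.rpow_const (by fun_prop) fun ξ => Or.inl (by positivity)
      have h2 := hφεs.continuous
      simp only [hw]
      fun_prop
    refine le_trans ?_ (Complex.re_le_norm _)
    have hre : (∫ ξ, w ξ).re = ∫ ξ, (w ξ).re :=
      (Complex.reCLM.integral_comp_comm hwi).symm
    have hwre : ∀ ξ, (w ξ).re = Real.cos ⟪x, ξ⟫ * (1 + ‖ξ‖ ^ 2) ^ (-s / 2) * Ψ (ε • ξ) := by
      intro ξ
      simp only [hw, hφε, hφ]
      rw [Complex.re_mul_ofReal, Complex.re_mul_ofReal, mul_comm Complex.I,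
        Complex.exp_ofReal_mul_I_re]
    have hlow : ∫ ξ : V n, 1 / 2 * 10 ^ (-|s / 2|) * ε ^ s * Ψ (ε • ξ) ≤ ∫ ξ, (w ξ).re := by
      refine integral_mono_of_nonneg (Filter.Eventually.of_forall fun ξ => ?_) hwi.re
        (Filter.Eventually.of_forall fun ξ => ?_)
      · have := Ψ.nonneg (x := ε • ξ)
        simp only [Pi.zero_apply]
        positivity
      · simp only [hwre]
        rcases eq_or_ne (Ψ (ε • ξ)) 0 with h | h
        · simp [h]
        · obtain ⟨h1, h3⟩ := hsupp _ h
          rw [norm_smul, Real.norm_eq_abs, abs_of_pos hε] at h1 h3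
          have hcos : 1 / 2 ≤ Real.cos ⟪x, ξ⟫ := by
            refine le_trans ?_ Real.one_sub_sq_div_two_le_cos
            have h4 : |⟪x, ξ⟫| ≤ 1 := by
              refine (abs_real_inner_le_norm x ξ).trans ?_
              nlinarith [norm_nonneg ξ]
            have := sq_le_one_iff_abs_le_one _ |>.2 h4
            linarith
          have hp := le_one_add_sq_rpow (s := s) hε hε1 h1 h3
          have := Ψ.nonneg (x := ε • ξ)
          have h5 : 1 / 2 * (10 ^ (-|s / 2|) * ε ^ s) ≤
              Real.cos ⟪x, ξ⟫ * (1 + ‖ξ‖ ^ 2) ^ (-s / 2) := by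
            gcongr
          rw [← mul_assoc] at h5
          exact mul_le_mul_of_nonneg_right h5 this
    rw [hre]
    refine le_trans (le_of_eq ?_) hlow
    rw [integral_const_mul, hscale Ψ, sub_eq_add_neg, Real.rpow_add hε]
    ring

lemma eLpNorm_le_of_norm_le_of_integral_sq {n : ℕ} (f : SchwartzMap (V n) ℂ) {p M : ℝ}
    (hp : 2 ≤ p) (hM : ∀ x, ‖f x‖ ≤ M) :
    eLpNorm f (ENNReal.ofReal p) volume ≤
      ENNReal.ofReal ((M ^ (p - 2) * ∫ x, ‖f x‖ ^ 2) ^ (1 / p)) := by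
  have hp0 : 0 < p := by linarith
  have hM0 : 0 ≤ M := (norm_nonneg _).trans (hM 0)
  have hi : Integrable fun x => M ^ (p - 2) * ‖f x‖ ^ 2 :=
    ((f.memLp 2 volume).integrable_norm_pow two_ne_zero).const_mul _
  rw [eLpNorm_eq_lintegral_rpow_enorm_toReal (by simpa using hp0) ENNReal.ofReal_ne_top,
    ENNReal.toReal_ofReal hp0.le, ← integral_const_mul,
    ← ENNReal.ofReal_rpow_of_nonneg (integral_nonneg fun _ => by positivity) (by positivity),
    ofReal_integral_eq_lintegral_ofReal hi (Filter.Eventually.of_forall fun _ => by positivity)]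
  gcongr with x
  rw [← ofReal_norm, ENNReal.ofReal_rpow_of_nonneg (norm_nonneg _) hp0.le]
  apply ENNReal.ofReal_le_ofReal
  have : ‖f x‖ ^ p = ‖f x‖ ^ (p - 2) * ‖f x‖ ^ 2 := by
    rw [← Real.rpow_two, ← Real.rpow_add_of_nonneg (norm_nonneg _) (by linarith) (by norm_num)]
    congr 1
    ring
  rw [this]
  gcongr
  exact hM x

lemma le_eLpNorm_of_le_norm_on_ball {n : ℕ} {G : V n → ℂ} {p c ρ : ℝ} (hp : 0 < p) (hc : 0 ≤ c)
    (hρ : 0 ≤ ρ) (hG : ∀ x, ‖x‖ ≤ ρ → c ≤ ‖G x‖) :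
    ENNReal.ofReal (c * (ρ ^ n * volume.real (Metric.ball (0 : V n) 1)) ^ (1 / p)) ≤
      eLpNorm G (ENNReal.ofReal p) volume := by
  have h1 : eLpNorm ((Metric.closedBall (0 : V n) ρ).indicator fun _ => c)
      (ENNReal.ofReal p) volume ≤ eLpNorm G (ENNReal.ofReal p) volume := by
    refine eLpNorm_mono fun x => ?_
    by_cases hx : x ∈ Metric.closedBall (0 : V n) ρ
    · rw [Set.indicator_of_mem hx, Real.norm_eq_abs, abs_of_nonneg hc]
      exact hG x (by simpa using hx)
    · rw [Set.indicator_of_notMem hx]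
      simp
  refine le_trans (le_of_eq ?_) h1
  rw [eLpNorm_indicator_const measurableSet_closedBall (by simpa using hp) ENNReal.ofReal_ne_top,
    ENNReal.toReal_ofReal hp.le, Measure.addHaar_closedBall _ _ hρ, finrank_euclideanSpace_fin,
    ENNReal.ofReal_mul hc, Real.enorm_eq_ofReal hc,
    ← ENNReal.ofReal_rpow_of_nonneg (by positivity) (by positivity),
    ENNReal.ofReal_mul (by positivity), ofReal_measureReal (by finiteness)]

open scoped Topology in
lemma not_forall_mul_rpow_le {a b α β : ℝ} (ha : 0 < a) (hαβ : α < β) :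
    ¬ ∀ ε : ℝ, 0 < ε → ε ≤ 1 → a * ε ^ α ≤ b * ε ^ β := by
  intro h
  have ht : Filter.Tendsto (fun ε : ℝ => b * ε ^ (β - α)) (𝓝[>] 0) (𝓝 0) := by
    have h1 := (Real.continuousAt_rpow_const 0 (β - α) (Or.inr (by linarith))).tendsto
    rw [Real.zero_rpow (by linarith)] at h1
    simpa using (h1.mono_left nhdsWithin_le_nhds).const_mul b
  have hev : ∀ᶠ ε in 𝓝[>] (0 : ℝ), a ≤ b * ε ^ (β - α) := by
    filter_upwards [Ioc_mem_nhdsGT (zero_lt_one' ℝ)] with ε hε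
    have h1 := h ε hε.1 hε.2
    have h2 : ε ^ β = ε ^ (β - α) * ε ^ α := by
      rw [← Real.rpow_add hε.1]
      congr 1
      ring
    rw [h2, ← mul_assoc] at h1
    exact le_of_mul_le_mul_right h1 (Real.rpow_pos_of_pos hε.1 _)
  exact absurd (ge_of_tendsto ht hev) (not_le.2 ha)

/-- for `n ≥ 2` and `2 ≤ p < ∞`, the fixed-time exponent
`s̄_p = (n−1)(1/2 − 1/p)` for `e^{i√(−Δ)}` cannot be replaced by any smaller exponent:
for every `s < s̄_p` there is no constant `C` with
`‖⟨D⟩^{−s} e^{i√(−Δ)} f‖_{L^p} ≤ C‖f‖_{L^p}` for all Schwartz `f`. -/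
theorem halfWave_fixed_time_sharp (n : ℕ) (hn : 2 ≤ n) (p : ℝ) (hp : 2 ≤ p) :
    ∀ s : ℝ, s < (n - 1) * (1 / 2 - 1 / p) →
      ¬ ∃ C : ℝ, ∀ f : SchwartzMap (V n) ℂ,
        eLpNorm (besselD (-s) (halfWave 1 ⇑f)) (ENNReal.ofReal p) volume
          ≤ ENNReal.ofReal C * eLpNorm (⇑f) (ENNReal.ofReal p) volume := by
  intro s hs
  rintro ⟨K, hK⟩
  have hp0 : 0 < p := by linarith
  obtain ⟨C, c, hC, hc, hfam⟩ := exists_focusing_data (n := n) (by omega) s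
  set v : ℝ := volume.real (Metric.ball (0 : V n) 1) with hv
  have hv0 : 0 < v := ENNReal.toReal_pos (Metric.measure_ball_pos _ _ one_pos).ne' measure_ball_lt_top.ne
  have hαβ : s - n + n / p < (-((n : ℝ) + 1) / 2 * (p - 2) + -(n : ℝ)) * (1 / p) := by
    have h1 : (-((n : ℝ) + 1) / 2 * (p - 2) + -(n : ℝ)) * (1 / p) =
        -((n : ℝ) + 1) / 2 + 1 / p := by
      field_simp
      ring
    rw [h1]
    have h2 : ((n : ℝ) - 1) * (1 / 2 - 1 / p) =
        ((n : ℝ) - 1) / 2 - n / p + 1 / p := by ring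
    linarith
  refine not_forall_mul_rpow_le (a := c * ((1 / 3) ^ n * v) ^ (1 / p))
    (b := max K 0 * (C ^ (p - 2) * C) ^ (1 / p)) (by positivity) hαβ fun ε hε hε1 => ?_
  obtain ⟨f, hfM, hf2, hfG⟩ := hfam ε hε hε1
  have hlow := le_eLpNorm_of_le_norm_on_ball hp0 (by positivity) (by positivity) hfG
  have hup := eLpNorm_le_of_norm_le_of_integral_sq f hp hfM
  have h1 : ENNReal.ofReal (c * ε ^ (s - n) * ((ε / 3) ^ n * v) ^ (1 / p)) ≤
      ENNReal.ofReal (max K 0 * (((C * ε ^ (-((n : ℝ) + 1) / 2)) ^ (p - 2) *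
        (C * ε ^ (-(n : ℝ)))) ^ (1 / p))) := by
    refine hlow.trans ((hK f).trans ?_)
    rw [ENNReal.ofReal_mul (le_max_right _ _)]
    gcongr
    · exact le_max_left _ _
    · refine hup.trans (ENNReal.ofReal_le_ofReal ?_)
      gcongr
  rw [ENNReal.ofReal_le_ofReal_iff (by positivity)] at h1
  have hL : c * ε ^ (s - n) * ((ε / 3) ^ n * v) ^ (1 / p) =
      c * ((1 / 3) ^ n * v) ^ (1 / p) * ε ^ (s - n + n / p) := by
    have : (ε / 3) ^ n * v = ε ^ (n : ℝ) * ((1 / 3) ^ n * v) := by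
      rw [Real.rpow_natCast, div_eq_mul_one_div, mul_pow]
      ring
    rw [this, Real.mul_rpow (by positivity) (by positivity), ← Real.rpow_mul hε.le,
      Real.rpow_add hε, mul_one_div]
    ring
  have hR : ((C * ε ^ (-((n : ℝ) + 1) / 2)) ^ (p - 2) * (C * ε ^ (-(n : ℝ)))) ^ (1 / p) =
      (C ^ (p - 2) * C) ^ (1 / p) *
        ε ^ ((-((n : ℝ) + 1) / 2 * (p - 2) + -(n : ℝ)) * (1 / p)) := by
    rw [Real.mul_rpow hC (by positivity), ← Real.rpow_mul hε.le, mul_mul_mul_comm,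
      ← Real.rpow_add hε, Real.mul_rpow (by positivity) (by positivity), ← Real.rpow_mul hε.le]
  rw [hL, hR, ← mul_assoc] at h1
  exact h1
end
end

section
/- Let n ≥ 2 and 2 < p < ∞. For every σ > 1/p there is no constant C such that (∫₁² ‖⟨D⟩^{σ−s̄_p} e^{it√(−Δ)} f‖^p_{L^p(ℝⁿ)} dt)^{1/p} ≤ C‖f‖_{L^p(ℝⁿ)} holds for all f in the Schwartz class S(ℝⁿ); that is, in the local smoothing conjecture for the euclidean half-wave propagator the regularity gain 1/p cannot be replaced by any larger number. -/
open MeasureTheory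
open scoped RealInnerProductSpace ENNReal

noncomputable section

/-- The regularity exponent `s̄_p = (n−1)|1/2 − 1/p|`. -/
def sBar (n : ℕ) (p : ℝ) : ℝ := (n - 1) * |1 / 2 - 1 / p|

/-- A case of the Cauchy–Schlömilch transformation. -/
lemma integral_exp_neg_sq_add_sq_div_sq {b : ℝ} (hb : 0 ≤ b) :
    ∫ v in Set.Ioi (0 : ℝ), Real.exp (-v ^ 2 - b ^ 2 / v ^ 2) =
      √Real.pi / 2 * Real.exp (-2 * b) := by
  rcases hb.eq_or_lt with rfl | hb
  · simpa using integral_gaussian_Ioi 1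
  set r : ℝ → ℝ := fun y => √(y ^ 2 + 4 * b) with hr
  have hr2 : ∀ y, r y ^ 2 = y ^ 2 + 4 * b := fun y => Real.sq_sqrt (by positivity)
  have hr0 : ∀ y, 0 < r y := fun y => Real.sqrt_pos.2 (by positivity)
  have hry : ∀ y, |y| < r y := fun y => by
    rw [← Real.sqrt_sq_eq_abs]
    exact Real.sqrt_lt_sqrt (sq_nonneg y) (by linarith)
  have hpos : ∀ y, 0 < (y + r y) / 2 := fun y => by
    have := (abs_lt.1 (hry y)).1
    linarith
  have himg : (fun y => (y + r y) / 2) '' Set.univ = Set.Ioi 0 := by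
    ext v
    simp only [Set.image_univ, Set.mem_range, Set.mem_Ioi]
    refine ⟨fun ⟨y, hy⟩ => hy ▸ hpos y, fun hv => ⟨v - b / v, ?_⟩⟩
    have : r (v - b / v) = v + b / v := by
      rw [hr]
      simp only
      rw [show (v - b / v) ^ 2 + 4 * b = (v + b / v) ^ 2 by field_simp; ring,
        Real.sqrt_sq (by positivity)]
    rw [this]
    ring
  have hinv : ∀ y, (y + r y) / 2 - b / ((y + r y) / 2) = y := fun y => by
    have := hpos y
    have hb' : b = (y + r y) / 2 * ((y + r y) / 2 - y) := by linarith [hr2 y]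
    rw [sub_eq_iff_eq_add, ← sub_eq_iff_eq_add', eq_div_iff this.ne']
    linarith
  have hderiv : ∀ y, HasDerivAt (fun y => (y + r y) / 2) ((1 + y / r y) / 2) y := fun y => by
    have h1 : HasDerivAt (fun y : ℝ => y ^ 2 + 4 * b) (2 * y) y := by
      simpa using (hasDerivAt_pow 2 y).add_const (4 * b)
    have h2 := h1.sqrt (by positivity)
    refine (((hasDerivAt_id y).add h2).div_const 2).congr_deriv ?_
    rw [mul_div_mul_left _ _ two_ne_zero]
  have hinj : Set.InjOn (fun y => (y + r y) / 2) Set.univ := fun x _ y _ hxy => by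
    have hxy' : (x + r x) / 2 = (y + r y) / 2 := hxy
    rw [← hinv x, ← hinv y, hxy']
  rw [← himg, integral_image_eq_integral_abs_deriv_smul MeasurableSet.univ
    (fun y _ => (hderiv y).hasDerivWithinAt) hinj, setIntegral_univ]
  have hodd : ∫ y : ℝ, y / r y * Real.exp (-y ^ 2) = 0 := by
    have h := integral_neg_eq_self (fun y : ℝ => y / r y * Real.exp (-y ^ 2)) volume
    have h' : ∀ y : ℝ, (-y) / r (-y) * Real.exp (-(-y) ^ 2) = -(y / r y * Real.exp (-y ^ 2)) :=
      fun y => by simp only [hr, neg_sq]; ring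
    simp only [h', integral_neg] at h
    linarith
  have hint : Integrable (fun y : ℝ => Real.exp (-y ^ 2)) := by
    simpa using integrable_exp_neg_mul_sq one_pos
  have hint' : Integrable (fun y : ℝ => y / r y * Real.exp (-y ^ 2)) := by
    refine hint.mono' (by fun_prop) (ae_of_all _ fun y => ?_)
    rw [norm_mul, Real.norm_of_nonneg (Real.exp_pos _).le, Real.norm_eq_abs, abs_div,
      abs_of_pos (hr0 y)]
    exact mul_le_of_le_one_left (Real.exp_pos _).le ((div_le_one (hr0 y)).2 (hry y).le)
  have key : ∀ y, |(1 + y / r y) / 2| • Real.exp (-((y + r y) / 2) ^ 2 - b ^ 2 / ((y + r y) / 2) ^ 2)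
      = Real.exp (-2 * b) / 2 * (Real.exp (-y ^ 2) + y / r y * Real.exp (-y ^ 2)) := fun y => by
    have h1 : 0 ≤ 1 + y / r y := by
      have : -1 ≤ y / r y := by
        rw [le_div_iff₀ (hr0 y)]
        linarith [(abs_lt.1 (hry y)).1]
      linarith
    have h2 : -((y + r y) / 2) ^ 2 - b ^ 2 / ((y + r y) / 2) ^ 2 = -2 * b + -y ^ 2 := by
      conv_rhs => rw [← hinv y]
      have := (hpos y).ne'
      generalize (y + r y) / 2 = v at this
      field_simp
      ring
    rw [h2, Real.exp_add, abs_of_nonneg (by positivity), smul_eq_mul]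
    ring
  simp only [key]
  rw [integral_const_mul, integral_add hint hint', hodd, add_zero]
  have := integral_gaussian 1
  simp only [neg_mul, one_mul, div_one] at this
  rw [this]
  ring

lemma integrable_exp_neg_mul_norm {n : ℕ} (hn : n ≠ 0) {a : ℝ} (ha : 0 < a) :
    Integrable (fun ξ : V n => Real.exp (-a * ‖ξ‖)) := by
  have : Nonempty (Fin n) := ⟨⟨0, Nat.pos_of_ne_zero hn⟩⟩
  rw [integrable_fun_norm_addHaar (μ := (volume : Measure (V n)))
    (f := fun y => Real.exp (-a * y))]
  refine (integrableOn_rpow_mul_exp_neg_mul_rpow (p := 1) (s := ((n - 1 : ℕ) : ℝ)) (b := a)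
    (by have : (0 : ℝ) ≤ ((n - 1 : ℕ) : ℝ) := by positivity
        linarith) one_pos ha).congr_fun (fun y hy => ?_) measurableSet_Ioi
  simp

/-- The Fourier integral of the Poisson semigroup, at complex time `τ`. -/
def poissonIntegral {n : ℕ} (x : V n) (τ : ℂ) : ℂ :=
  ∫ ξ : V n, Complex.exp (Complex.I * ((⟪x, ξ⟫ : ℝ) : ℂ)) * Complex.exp (-τ * (‖ξ‖ : ℂ))

/-- The function `τ (τ² + |x|²)^{-(n+1)/2}`. -/
def poissonFn {n : ℕ} (x : V n) (τ : ℂ) : ℂ :=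
  τ * (τ ^ 2 + ((‖x‖ ^ 2 : ℝ) : ℂ)) ^ ((-((n : ℝ) + 1) / 2 : ℝ) : ℂ)

lemma norm_exp_I_mul (a : ℝ) : ‖Complex.exp (Complex.I * (a : ℂ))‖ = 1 := by
  rw [mul_comm, Complex.norm_exp_ofReal_mul_I]

lemma norm_exp_neg_mul (τ : ℂ) (r : ℝ) :
    ‖Complex.exp (-τ * (r : ℂ))‖ = Real.exp (-τ.re * r) := by
  rw [Complex.norm_exp]
  simp

lemma differentiableOn_poissonIntegral {n : ℕ} (hn : n ≠ 0) (x : V n) :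
    DifferentiableOn ℂ (poissonIntegral x) {τ | 0 < τ.re} := by
  intro τ hτ
  simp only [Set.mem_ofPred_eq] at hτ
  refine DifferentiableAt.differentiableWithinAt ?_
  set a := τ.re / 2 with ha
  have ha0 : 0 < a := by positivity
  have hs : {z : ℂ | a < z.re} ∈ nhds τ :=
    (isOpen_lt continuous_const Complex.continuous_re).mem_nhds (by
      simp only [Set.mem_ofPred_eq]; linarith)
  refine (hasDerivAt_integral_of_dominated_loc_of_deriv_le (μ := (volume : Measure (V n)))
    (F := fun τ ξ => Complex.exp (Complex.I * ((⟪x, ξ⟫ : ℝ) : ℂ)) *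
      Complex.exp (-τ * (‖ξ‖ : ℂ)))
    (F' := fun τ ξ => Complex.exp (Complex.I * ((⟪x, ξ⟫ : ℝ) : ℂ)) *
      (Complex.exp (-τ * (‖ξ‖ : ℂ)) * (-(‖ξ‖ : ℂ))))
    (bound := fun ξ => 2 / a * Real.exp (-(a / 2) * ‖ξ‖))
    hs (Filter.Eventually.of_forall fun z => ?_) ?_ ?_ ?_ ?_ ?_).2.differentiableAt
  · fun_prop
  · refine (integrable_exp_neg_mul_norm hn hτ).mono' (by fun_prop) (ae_of_all _ fun ξ => ?_)
    rw [norm_mul, norm_exp_I_mul, norm_exp_neg_mul, one_mul]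
  · fun_prop
  · refine ae_of_all _ fun ξ z hz => ?_
    simp only [Set.mem_ofPred_eq] at hz
    rw [norm_mul, norm_exp_I_mul, norm_mul, norm_exp_neg_mul, one_mul, norm_neg,
      Complex.norm_real, norm_norm]
    have h1 : Real.exp (-z.re * ‖ξ‖) ≤ Real.exp (-(a / 2) * ‖ξ‖) * Real.exp (-(a / 2) * ‖ξ‖) := by
      rw [← Real.exp_add]
      gcongr
      nlinarith [norm_nonneg ξ]
    have h2 : Real.exp (-(a / 2) * ‖ξ‖) * ‖ξ‖ ≤ 2 / a := by
      have := Real.add_one_le_exp (a / 2 * ‖ξ‖)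
      rw [neg_mul, Real.exp_neg, inv_mul_le_iff₀ (Real.exp_pos _)]
      calc ‖ξ‖ = (a / 2 * ‖ξ‖) * (2 / a) := by field_simp
        _ ≤ _ := by gcongr; linarith
    calc _ ≤ (Real.exp (-(a / 2) * ‖ξ‖) * Real.exp (-(a / 2) * ‖ξ‖)) * ‖ξ‖ := by gcongr
      _ = (Real.exp (-(a / 2) * ‖ξ‖) * ‖ξ‖) * Real.exp (-(a / 2) * ‖ξ‖) := by ring
      _ ≤ _ := by gcongr
  · exact (integrable_exp_neg_mul_norm hn (by positivity)).const_mul _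
  · refine ae_of_all _ fun ξ z _ => HasDerivAt.const_mul _ ?_
    have := ((hasDerivAt_id z).neg.mul_const (‖ξ‖ : ℂ)).cexp
    simpa using this

lemma differentiableOn_poissonFn {n : ℕ} (x : V n) :
    DifferentiableOn ℂ (poissonFn x) {τ | 0 < τ.re} := by
  intro τ hτ
  simp only [Set.mem_ofPred_eq] at hτ
  refine DifferentiableAt.differentiableWithinAt ?_
  refine differentiableAt_id.mul (DifferentiableAt.cpow (by fun_prop) (by fun_prop) ?_)
  rw [Complex.mem_slitPlane_iff]
  by_cases h : τ.im = 0
  · left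
    simp only [pow_two, Complex.add_re, Complex.mul_re, h, Complex.ofReal_re]
    nlinarith [mul_self_nonneg ‖x‖, mul_pos hτ hτ]
  · right
    simp only [pow_two, Complex.add_im, Complex.mul_im, Complex.ofReal_im, add_zero]
    intro h'
    exact h (by nlinarith [mul_ne_zero hτ.ne' h])

lemma integral_exp_gaussian {n : ℕ} (x : V n) {τ v : ℝ} (hτ : 0 < τ) (hv : 0 < v) :
    ∫ ξ : V n, Complex.exp (Complex.I * ((⟪x, ξ⟫ : ℝ) : ℂ)) *
        ((Real.exp (-v ^ 2 - (τ * ‖ξ‖ / 2) ^ 2 / v ^ 2) : ℝ) : ℂ) =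
      (((2 * √Real.pi / τ) ^ n * (v ^ (n : ℝ) *
        Real.exp (-((τ ^ 2 + ‖x‖ ^ 2) / τ ^ 2) * v ^ (2 : ℝ))) : ℝ) : ℂ) := by
  set b : ℝ := τ ^ 2 / (4 * v ^ 2) with hb
  have hb0 : 0 < b := by positivity
  have h1 : ∀ ξ : V n, Complex.exp (Complex.I * ((⟪x, ξ⟫ : ℝ) : ℂ)) *
        ((Real.exp (-v ^ 2 - (τ * ‖ξ‖ / 2) ^ 2 / v ^ 2) : ℝ) : ℂ) =
      ((Real.exp (-v ^ 2) : ℝ) : ℂ) *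
        Complex.exp (-(b : ℂ) * (‖ξ‖ : ℂ) ^ 2 + Complex.I * ((⟪x, ξ⟫ : ℝ) : ℂ)) := fun ξ => by
    rw [Complex.ofReal_exp, Complex.ofReal_exp, ← Complex.exp_add, ← Complex.exp_add, hb]
    congr 1
    have hv' : (v : ℂ) ≠ 0 := Complex.ofReal_ne_zero.2 hv.ne'
    push_cast
    field_simp
    ring
  have h2 : ((Real.pi : ℂ) / (b : ℂ)) ^ ((Module.finrank ℝ (V n) : ℂ) / 2) =
      (((2 * √Real.pi / τ) ^ n * v ^ (n : ℝ) : ℝ) : ℂ) := by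
    rw [finrank_euclideanSpace_fin, ← Complex.ofReal_div,
      show ((n : ℂ) / 2) = (((n : ℝ) / 2 : ℝ) : ℂ) by push_cast; rfl,
      ← Complex.ofReal_cpow (by positivity), Real.rpow_div_two_eq_sqrt _ (by positivity),
      Real.rpow_natCast, Real.rpow_natCast, ← mul_pow]
    congr 2
    rw [Real.sqrt_eq_iff_mul_self_eq (by positivity) (by positivity), hb, ← pow_two, mul_pow, div_pow, mul_pow, Real.sq_sqrt Real.pi_pos.le]
    field_simp
    norm_num
  simp only [h1]
  rw [integral_const_mul, GaussianFourier.integral_cexp_neg_mul_sq_norm_add (by simpa using hb0), h2,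
    mul_left_comm, Complex.I_sq, Complex.ofReal_exp]
  have h3 : (-1 * (‖x‖ : ℂ) ^ 2 / (4 * (b : ℂ))) = ((-(‖x‖ ^ 2 * v ^ 2 / τ ^ 2) : ℝ) : ℂ) := by
    rw [hb]
    push_cast
    field_simp
  rw [h3, ← Complex.exp_add, ← Complex.ofReal_add, ← Complex.ofReal_exp, ← Complex.ofReal_mul,
    mul_assoc, Real.rpow_two]
  congr 5
  field_simp
  ring

lemma poissonIntegral_ofReal {n : ℕ} (hn : n ≠ 0) (x : V n) {τ : ℝ} (hτ : 0 < τ) :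
    poissonIntegral x (τ : ℂ) =
      (((2 * √Real.pi) ^ n * Real.Gamma (((n : ℝ) + 1) / 2) / √Real.pi : ℝ) : ℂ) *
        poissonFn x (τ : ℂ) := by
  set w : V n → ℝ → ℝ := fun ξ v => Real.exp (-v ^ 2 - (τ * ‖ξ‖ / 2) ^ 2 / v ^ 2) with hw
  have hw_int : ∀ ξ, ∫ v in Set.Ioi (0 : ℝ), w ξ v = √Real.pi / 2 * Real.exp (-τ * ‖ξ‖) := by
    intro ξ
    rw [integral_exp_neg_sq_add_sq_div_sq (by positivity)]
    congr 2
    ring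
  have hw_meas : Measurable (fun z : V n × ℝ => w z.1 z.2) := by
    simp only [hw]
    fun_prop
  have hprod : Integrable (Function.uncurry fun (ξ : V n) (v : ℝ) =>
      Complex.exp (Complex.I * ((⟪x, ξ⟫ : ℝ) : ℂ)) * ((w ξ v : ℝ) : ℂ))
      (volume.prod (volume.restrict (Set.Ioi 0))) := by
    have hmeas : Measurable (Function.uncurry fun (ξ : V n) (v : ℝ) =>
        Complex.exp (Complex.I * ((⟪x, ξ⟫ : ℝ) : ℂ)) * ((w ξ v : ℝ) : ℂ)) := by
      have : Measurable (fun z : V n × ℝ => ((w z.1 z.2 : ℝ) : ℂ)) :=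
        Complex.measurable_ofReal.comp hw_meas
      refine Measurable.mul ?_ this
      fun_prop
    have hnorm : ∀ ξ v, ‖Complex.exp (Complex.I * ((⟪x, ξ⟫ : ℝ) : ℂ)) * ((w ξ v : ℝ) : ℂ)‖ =
        w ξ v := fun ξ v => by
      rw [norm_mul, norm_exp_I_mul, one_mul, Complex.norm_real,
        Real.norm_of_nonneg (Real.exp_pos _).le]
    rw [integrable_prod_iff hmeas.aestronglyMeasurable]
    simp only [Function.uncurry_apply_pair, hnorm, hw_int]
    refine ⟨ae_of_all _ fun ξ => ?_, (integrable_exp_neg_mul_norm hn hτ).const_mul _⟩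
    have hg : Integrable (fun v : ℝ => Real.exp (-v ^ 2)) (volume.restrict (Set.Ioi 0)) := by
      simpa using (integrable_exp_neg_mul_sq one_pos).restrict
    refine hg.mono' (hmeas.comp measurable_prodMk_left).aestronglyMeasurable
      (ae_of_all _ fun v => ?_)
    rw [hnorm]
    simp only [hw]
    gcongr
    have : 0 ≤ (τ * ‖ξ‖ / 2) ^ 2 / v ^ 2 := by positivity
    linarith
  have hswap := integral_integral_swap hprod
  have hL : ∀ ξ : V n, ∫ v in Set.Ioi (0 : ℝ),
      Complex.exp (Complex.I * ((⟪x, ξ⟫ : ℝ) : ℂ)) * ((w ξ v : ℝ) : ℂ) =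
      ((√Real.pi / 2 : ℝ) : ℂ) *
        (Complex.exp (Complex.I * ((⟪x, ξ⟫ : ℝ) : ℂ)) * Complex.exp (-τ * (‖ξ‖ : ℂ))) := fun ξ => by
    rw [integral_const_mul, integral_complex_ofReal, hw_int]
    push_cast
    ring
  simp only [hL] at hswap
  rw [integral_const_mul, setIntegral_congr_fun measurableSet_Ioi
    (fun v hv => integral_exp_gaussian x hτ hv), integral_complex_ofReal, integral_const_mul,
    integral_rpow_mul_exp_neg_mul_rpow two_pos
      (by have : (0 : ℝ) ≤ n := n.cast_nonneg
          linarith) (by positivity)] at hswap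
  have hpi : (√Real.pi / 2 : ℝ) ≠ 0 := by positivity
  have hF : poissonFn x (τ : ℂ) =
      ((τ * (τ ^ 2 + ‖x‖ ^ 2) ^ (-((n : ℝ) + 1) / 2) : ℝ) : ℂ) := by
    rw [poissonFn, ← Complex.ofReal_pow, ← Complex.ofReal_add,
      ← Complex.ofReal_cpow (by positivity), ← Complex.ofReal_mul]
  have hτp : (τ ^ 2 : ℝ) ^ (-((n : ℝ) + 1) / 2) = (τ ^ (n + 1))⁻¹ := by
    rw [Real.rpow_div_two_eq_sqrt _ (by positivity), Real.sqrt_sq hτ.le, Real.rpow_neg hτ.le,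
      ← Nat.cast_succ, Real.rpow_natCast]
  have := mul_left_cancel₀ (Complex.ofReal_ne_zero.2 hpi)
    (a := ((√Real.pi / 2 : ℝ) : ℂ)) (b := poissonIntegral x (τ : ℂ))
    (c := (((2 * √Real.pi) ^ n * Real.Gamma (((n : ℝ) + 1) / 2) / √Real.pi : ℝ) : ℂ) *
        poissonFn x (τ : ℂ)) ?_
  · exact this
  · refine hswap.trans ?_
    rw [hF, ← Complex.ofReal_mul, ← Complex.ofReal_mul, Complex.ofReal_inj,
      Real.div_rpow (by positivity) (by positivity), hτp, div_pow]
    field_simp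
    ring

/-- The Poisson kernel formula at complex times. -/
lemma poissonIntegral_eq {n : ℕ} (hn : n ≠ 0) (x : V n) {τ : ℂ} (hτ : 0 < τ.re) :
    poissonIntegral x τ =
      (((2 * √Real.pi) ^ n * Real.Gamma (((n : ℝ) + 1) / 2) / √Real.pi : ℝ) : ℂ) *
        poissonFn x τ := by
  have hopen : IsOpen {τ : ℂ | 0 < τ.re} := isOpen_lt continuous_const Complex.continuous_re
  have hpre : IsPreconnected {τ : ℂ | 0 < τ.re} := (convex_halfSpace_re_gt 0).isPreconnected
  refine ((differentiableOn_poissonIntegral hn x).analyticOnNhd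
    hopen).eqOn_of_preconnected_of_frequently_eq
    (((differentiableOn_poissonFn x).const_mul _).analyticOnNhd hopen) hpre
    (z₀ := ((1 : ℝ) : ℂ)) (by simp) ?_ hτ
  have hreal : ∃ᶠ r : ℝ in nhdsWithin 1 {1}ᶜ, poissonIntegral x (r : ℂ) =
      (((2 * √Real.pi) ^ n * Real.Gamma (((n : ℝ) + 1) / 2) / √Real.pi : ℝ) : ℂ) *
        poissonFn x (r : ℂ) := by
    refine Filter.Eventually.frequently ?_
    filter_upwards [mem_nhdsWithin_of_mem_nhds (lt_mem_nhds (zero_lt_one' ℝ))] with r hr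
    exact poissonIntegral_ofReal hn x hr
  refine Filter.Tendsto.frequently ?_ hreal
  exact (Complex.continuous_ofReal.continuousAt).continuousWithinAt.tendsto_nhdsWithin
    fun r hr => by simpa using hr

lemma norm_poissonIntegral_le {n : ℕ} (hn : n ≠ 0) :
    ∃ C : ℝ, 0 < C ∧ ∀ ε : ℝ, 0 < ε → ε ≤ 1 → ∀ x : V n,
      ‖poissonIntegral x ((ε : ℂ) + Complex.I)‖ ≤ C * ε ^ (-((n : ℝ) + 1) / 2) := by
  have hpi := Real.sqrt_pos.2 Real.pi_pos
  have hG : 0 < Real.Gamma (((n : ℝ) + 1) / 2) := Real.Gamma_pos_of_pos (by positivity)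
  refine ⟨(2 * √Real.pi) ^ n * Real.Gamma (((n : ℝ) + 1) / 2) / √Real.pi * 2, by positivity,
    fun ε hε hε1 x => ?_⟩
  rw [poissonIntegral_eq hn x (by simpa using hε), norm_mul, Complex.norm_real,
    Real.norm_of_nonneg (by positivity), mul_assoc]
  gcongr
  rw [poissonFn, norm_mul, Complex.norm_cpow_real]
  have h1 : ‖(ε : ℂ) + Complex.I‖ ≤ 2 := by
    refine (norm_add_le _ _).trans ?_
    rw [Complex.norm_real, Real.norm_of_nonneg hε.le, Complex.norm_I]
    linarith
  have h2 : ε ≤ ‖((ε : ℂ) + Complex.I) ^ 2 + ((‖x‖ ^ 2 : ℝ) : ℂ)‖ := by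
    refine le_trans ?_ (Complex.abs_im_le_norm _)
    rw [pow_two, Complex.add_im, Complex.mul_im, Complex.ofReal_im]
    simp only [Complex.add_re, Complex.ofReal_re, Complex.I_re, Complex.add_im, Complex.ofReal_im,
      Complex.I_im]
    rw [abs_of_nonneg (by linarith)]
    linarith
  gcongr ?_ * ?_
  exact Real.rpow_le_rpow_of_nonpos hε h2 (by
    have : (0 : ℝ) ≤ n := n.cast_nonneg
    linarith)

/-- The inverse of the Fourier transform `FT`. -/
def invFT {n : ℕ} (G : V n → ℂ) (x : V n) : ℂ :=
  ((((2 * Real.pi) ^ n)⁻¹ : ℝ) : ℂ) *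
    ∫ ξ : V n, Complex.exp (Complex.I * ((⟪x, ξ⟫ : ℝ) : ℂ)) * G ξ

open scoped FourierTransform in
/-- Fourier inversion and Plancherel's theorem for `FT` on Schwartz functions. -/
lemma exists_schwartzMap_eq_invFT {n : ℕ} (G : SchwartzMap (V n) ℂ) :
    ∃ g : SchwartzMap (V n) ℂ, ⇑g = invFT G ∧ (∀ ξ, FT g ξ = G ξ) ∧
      ∫ x, ‖g x‖ ^ 2 = ((2 * Real.pi) ^ n)⁻¹ * ∫ ξ, ‖G ξ‖ ^ 2 := by
  have hpi : (2 * Real.pi) ≠ 0 := by positivity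
  set e : V n ≃L[ℝ] V n := ContinuousLinearEquiv.smulLeft (Units.mk0 (2 * Real.pi) hpi) with he
  have he_apply : ∀ η, e η = (2 * Real.pi) • η := fun η => rfl
  set h : SchwartzMap (V n) ℂ := SchwartzMap.compCLMOfContinuousLinearEquiv ℂ e G with hh
  have hh_apply : ∀ η, h η = G ((2 * Real.pi) • η) := fun η => rfl
  have hscale : |((2 * Real.pi) ^ Module.finrank ℝ (V n))⁻¹| = ((2 * Real.pi) ^ n)⁻¹ := by
    rw [finrank_euclideanSpace_fin, abs_of_pos (by positivity)]
  refine ⟨𝓕⁻ h, ?_, ?_, ?_⟩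
  · ext x
    rw [SchwartzMap.fourierInv_coe, Real.fourierInv_eq', invFT]
    have := Measure.integral_comp_smul (volume : Measure (V n))
      (fun ξ => Complex.exp (Complex.I * ((⟪x, ξ⟫ : ℝ) : ℂ)) * G ξ) (2 * Real.pi)
    rw [hscale, Complex.real_smul] at this
    rw [← this]
    refine integral_congr_ae (ae_of_all _ fun η => ?_)
    simp only [hh_apply, smul_eq_mul, inner_smul_right, real_inner_comm x η]
    rw [mul_comm Complex.I]
  · intro ξ
    have h1 : 𝓕 (𝓕⁻ h) ((2 * Real.pi)⁻¹ • ξ) = h ((2 * Real.pi)⁻¹ • ξ) := by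
      rw [FourierTransform.fourier_fourierInv_eq]
    rw [hh_apply, smul_inv_smul₀ hpi, SchwartzMap.fourier_coe, Real.fourier_eq'] at h1
    rw [← h1, FT]
    refine integral_congr_ae (ae_of_all _ fun η => ?_)
    simp only [smul_eq_mul, inner_smul_right]
    congr 2
    push_cast
    field_simp
  · rw [← SchwartzMap.integral_norm_sq_fourier, FourierTransform.fourier_fourierInv_eq]
    simp only [hh_apply]
    rw [Measure.integral_comp_smul (volume : Measure (V n)) (fun ξ => ‖G ξ‖ ^ 2), hscale,
      smul_eq_mul]

/-- A smooth bump adapted to the annulus `1/2 ≤ |ξ| ≤ 3/2`. -/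
structure IsAnnulusBump {n : ℕ} (m : V n → ℝ) : Prop where
  contDiff : ContDiff ℝ (⊤ : ℕ∞) m
  hasCompactSupport : HasCompactSupport m
  nonneg : ∀ ξ, 0 ≤ m ξ
  le_one : ∀ ξ, m ξ ≤ 1
  half_le_norm : ∀ ξ, m ξ ≠ 0 → 1 / 2 ≤ ‖ξ‖
  norm_le : ∀ ξ, m ξ ≠ 0 → ‖ξ‖ ≤ 3 / 2
  integral_pos : 0 < ∫ ξ, m ξ

lemma exists_isAnnulusBump {n : ℕ} (hn : n ≠ 0) : ∃ m : V n → ℝ, IsAnnulusBump m := by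
  set c : V n := EuclideanSpace.single ⟨0, Nat.pos_of_ne_zero hn⟩ 1 with hc
  have hc1 : ‖c‖ = 1 := by simp [hc]
  let b : ContDiffBump c := ⟨1 / 4, 1 / 2, by norm_num, by norm_num⟩
  have hb : ∀ ξ, b ξ ≠ 0 → ‖ξ - c‖ < 1 / 2 := fun ξ hξ => by
    have : ξ ∈ Function.support b := hξ
    rwa [b.support_eq, mem_ball_iff_norm] at this
  refine ⟨b, b.contDiff, b.hasCompactSupport, fun ξ => b.nonneg, fun ξ => b.le_one,
    fun ξ hξ => ?_, fun ξ hξ => ?_, b.integral_pos⟩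
  · have h1 := hb ξ hξ
    have h2 := norm_sub_norm_le c ξ
    rw [norm_sub_rev] at h2
    linarith
  · have h1 := hb ξ hξ
    have h2 := norm_sub_norm_le ξ c
    linarith

/-- The symbol `⟨ξ⟩^s e^{-τ|ξ|} m(εξ)`. -/
def waveSymbol {n : ℕ} (m : V n → ℝ) (ε s : ℝ) (τ : ℂ) (ξ : V n) : ℂ :=
  (((1 + ‖ξ‖ ^ 2) ^ (s / 2) : ℝ) : ℂ) * (Complex.exp (-τ * (‖ξ‖ : ℂ)) * ((m (ε • ξ) : ℝ) : ℂ))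

lemma exists_schwartzMap_eq_waveSymbol {n : ℕ} {m : V n → ℝ} (hm : IsAnnulusBump m) {ε : ℝ}
    (hε : 0 < ε) (s : ℝ) (τ : ℂ) :
    ∃ G : SchwartzMap (V n) ℂ, ⇑G = waveSymbol m ε s τ := by
  have hsupp : HasCompactSupport (waveSymbol m ε s τ) := by
    have h1 : HasCompactSupport fun ξ : V n => m (ε • ξ) :=
      hm.hasCompactSupport.comp_homeomorph (Homeomorph.smulOfNeZero ε hε.ne')
    refine h1.mono fun ξ hξ => ?_
    rw [Function.mem_support] at hξ ⊢
    intro h0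
    exact hξ (by simp [waveSymbol, h0])
  have hsmooth : ContDiff ℝ (⊤ : ℕ∞) (waveSymbol m ε s τ) := by
    rw [contDiff_iff_contDiffAt]
    intro ξ
    by_cases hξ : ξ = 0
    · have hev : ∀ᶠ η in nhds ξ, waveSymbol m ε s τ η = 0 := by
        have : ∀ᶠ η : V n in nhds ξ, ‖ε • η‖ < 1 / 2 := by
          refine ContinuousAt.eventually_lt (by fun_prop) continuousAt_const ?_
          simp [hξ]
        filter_upwards [this] with η hη
        have : m (ε • η) = 0 := by
          by_contra h
          exact absurd (hm.half_le_norm _ h) (not_le.2 hη)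
        simp [waveSymbol, this]
      exact contDiffAt_const.congr_of_eventuallyEq hev
    · have hnorm : ContDiffAt ℝ (⊤ : ℕ∞) (fun η : V n => (‖η‖ : ℂ)) ξ :=
        Complex.ofRealCLM.contDiff.contDiffAt.comp ξ (contDiffAt_norm ℝ hξ)
      refine ContDiffAt.mul ?_ (ContDiffAt.mul ?_ ?_)
      · refine Complex.ofRealCLM.contDiff.contDiffAt.comp ξ ?_
        refine ContDiffAt.rpow_const_of_ne ?_ (by positivity)
        exact contDiffAt_const.add (contDiff_norm_sq ℝ).contDiffAt
      · exact (contDiffAt_const.mul hnorm).cexp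
      · refine Complex.ofRealCLM.contDiff.contDiffAt.comp ξ ?_
        exact (hm.contDiff.comp (contDiff_const_smul ε)).contDiffAt
  exact ⟨hsupp.toSchwartzMap hsmooth, rfl⟩

lemma halfWave_eq_invFT {n : ℕ} {m : V n → ℝ} {ε s : ℝ} {τ : ℂ} {f : V n → ℂ}
    (hf : ∀ ξ, FT f ξ = waveSymbol m ε s τ ξ) (t : ℝ) :
    halfWave t f = invFT (waveSymbol m ε s (τ - t * Complex.I)) := by
  ext x
  rw [halfWave, invFT]
  congr 2
  ext ξ
  rw [hf, waveSymbol, waveSymbol, Complex.ofReal_add, mul_add, Complex.exp_add,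
    show -(τ - t * Complex.I) * (‖ξ‖ : ℂ) =
      Complex.I * ((t * ‖ξ‖ : ℝ) : ℂ) + -τ * (‖ξ‖ : ℂ) by push_cast; ring, Complex.exp_add]
  ring

lemma besselD_eq_invFT {n : ℕ} {m : V n → ℝ} {ε : ℝ} {τ : ℂ} {g : V n → ℂ}
    (hg : ∀ ξ, FT g ξ = waveSymbol m ε 0 τ ξ) (s : ℝ) :
    besselD s g = invFT (waveSymbol m ε s τ) := by
  ext x
  rw [besselD, invFT]
  congr 2
  ext ξ
  rw [hg, waveSymbol, waveSymbol]
  simp [mul_assoc]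

lemma besselD_halfWave_eq_invFT {n : ℕ} {m : V n → ℝ} (hm : IsAnnulusBump m) {ε : ℝ}
    (hε : 0 < ε) {τ : ℂ} {f : V n → ℂ} (hf : ∀ ξ, FT f ξ = waveSymbol m ε 0 τ ξ) (s t : ℝ) :
    besselD s (halfWave t f) = invFT (waveSymbol m ε s (τ - t * Complex.I)) := by
  obtain ⟨G, hG⟩ := exists_schwartzMap_eq_waveSymbol hm hε 0 (τ - t * Complex.I)
  obtain ⟨g, hg, hFT, -⟩ := exists_schwartzMap_eq_invFT G
  refine besselD_eq_invFT (fun ξ => ?_) s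
  rw [halfWave_eq_invFT hf, ← hG, ← hg, hFT]

lemma two_rpow_neg_abs_mul_le {ε r : ℝ} (hε : 0 < ε) (hε1 : ε ≤ 1) (hr : 1 / 2 ≤ ε * r)
    (hr' : ε * r ≤ 3 / 2) (s : ℝ) :
    (2 : ℝ) ^ (-|s|) * ε ^ (-s) ≤ (1 + r ^ 2) ^ (s / 2) := by
  have h1 : (2 * ε)⁻¹ ^ 2 ≤ 1 + r ^ 2 := by
    have : (2 * ε)⁻¹ ≤ r := by
      rw [inv_le_iff_one_le_mul₀ (by positivity)]
      linarith
    nlinarith [pow_le_pow_left₀ (by positivity : 0 ≤ (2 * ε)⁻¹) this 2]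
  have h2 : 1 + r ^ 2 ≤ (2 / ε) ^ 2 := by
    rw [div_pow, le_div_iff₀ (by positivity)]
    nlinarith
  rcases le_total 0 s with hs | hs
  · calc (2 : ℝ) ^ (-|s|) * ε ^ (-s) = ((2 * ε)⁻¹ ^ 2) ^ (s / 2) := by
          rw [abs_of_nonneg hs, ← Real.mul_rpow (by norm_num) hε.le, ← Real.rpow_natCast,
            ← Real.rpow_mul (by positivity), Real.inv_rpow (by positivity),
            ← Real.rpow_neg (by positivity)]
          congr 1
          push_cast
          ring
      _ ≤ _ := Real.rpow_le_rpow (by positivity) h1 (by positivity)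
  · calc (2 : ℝ) ^ (-|s|) * ε ^ (-s) = ((2 / ε) ^ 2) ^ (s / 2) := by
          rw [abs_of_nonpos hs, ← Real.rpow_natCast, ← Real.rpow_mul (by positivity),
            Real.div_rpow (by norm_num) hε.le, Real.rpow_neg hε.le, neg_neg,
            show ((2 : ℕ) : ℝ) * (s / 2) = s by push_cast; ring, div_eq_mul_inv]
      _ ≤ _ := Real.rpow_le_rpow_of_nonpos (by positivity) h2 (by linarith)

lemma integral_comp_smul_euclidean {n : ℕ} (g : V n → ℝ) {ε : ℝ} (hε : 0 < ε) :
    ∫ ξ : V n, g (ε • ξ) = ε ^ (-(n : ℝ)) * ∫ ξ, g ξ := by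
  rw [Measure.integral_comp_smul, finrank_euclideanSpace_fin, abs_of_pos (by positivity),
    Real.rpow_neg hε.le, Real.rpow_natCast, smul_eq_mul]

/-- The wave is large near the focal point. -/
lemma exists_le_norm_invFT_waveSymbol {n : ℕ} {m : V n → ℝ} (hm : IsAnnulusBump m) (s : ℝ) :
    ∃ c : ℝ, 0 < c ∧ ∀ ε : ℝ, 0 < ε → ε ≤ 1 → ∀ t : ℝ, |t - 1| ≤ ε / 8 → ∀ x : V n,
      ‖x‖ ≤ ε / 8 →
      c * ε ^ (-s - n) ≤ ‖invFT (waveSymbol m ε s (ε + Complex.I - t * Complex.I)) x‖ := by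
  have hI := hm.integral_pos
  refine ⟨((2 * Real.pi) ^ n)⁻¹ * (1 / 2 * 2 ^ (-|s|) * Real.exp (-(3 / 2))) * ∫ ξ, m ξ,
    by positivity, fun ε hε hε1 t ht x hx => ?_⟩
  obtain ⟨G, hG⟩ := exists_schwartzMap_eq_waveSymbol hm hε s (ε + Complex.I - t * Complex.I)
  set H : V n → ℂ := fun ξ => Complex.exp (Complex.I * ((⟪x, ξ⟫ : ℝ) : ℂ)) *
    waveSymbol m ε s (ε + Complex.I - t * Complex.I) ξ with hH
  have hH_int : Integrable H := by
    rw [hH, ← hG]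
    refine G.integrable.norm.mono' (by have := G.continuous; fun_prop) (ae_of_all _ fun ξ => ?_)
    rw [norm_mul, norm_exp_I_mul, one_mul]
  have hre : ∀ ξ, (H ξ).re = (1 + ‖ξ‖ ^ 2) ^ (s / 2) * (Real.exp (-ε * ‖ξ‖) * m (ε • ξ)) *
      Real.cos (⟪x, ξ⟫ + (t - 1) * ‖ξ‖) := fun ξ => by
    have : H ξ = (((1 + ‖ξ‖ ^ 2) ^ (s / 2) * (Real.exp (-ε * ‖ξ‖) * m (ε • ξ)) : ℝ) : ℂ) *
        Complex.exp (((⟪x, ξ⟫ + (t - 1) * ‖ξ‖ : ℝ) : ℂ) * Complex.I) := by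
      rw [hH]
      simp only [waveSymbol]
      rw [show -(ε + Complex.I - t * Complex.I) * (‖ξ‖ : ℂ) =
        ((-ε * ‖ξ‖ : ℝ) : ℂ) + (((t - 1) * ‖ξ‖ : ℝ) : ℂ) * Complex.I by push_cast; ring,
        Complex.exp_add, Complex.ofReal_add, add_mul, Complex.exp_add,
        mul_comm Complex.I ((⟪x, ξ⟫ : ℝ) : ℂ)]
      simp only [Complex.ofReal_mul, Complex.ofReal_exp]
      ring
    rw [this, Complex.re_ofReal_mul, Complex.exp_ofReal_mul_I_re]
  have hbound : ∀ ξ, (1 / 2 * 2 ^ (-|s|) * Real.exp (-(3 / 2)) * ε ^ (-s)) * m (ε • ξ) ≤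
      (H ξ).re := fun ξ => by
    rw [hre]
    by_cases h0 : m (ε • ξ) = 0
    · simp [h0]
    have h1 := hm.half_le_norm _ h0
    have h2 := hm.norm_le _ h0
    rw [norm_smul, Real.norm_of_nonneg hε.le] at h1 h2
    have hm0 := hm.nonneg (ε • ξ)
    have hθ : |⟪x, ξ⟫ + (t - 1) * ‖ξ‖| ≤ 3 / 8 := by
      refine (abs_add_le _ _).trans ?_
      rw [abs_mul, abs_norm]
      have h3 := abs_real_inner_le_norm x ξ
      have h4 : ‖x‖ * ‖ξ‖ ≤ ε / 8 * ‖ξ‖ := by gcongr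
      have h5 : |t - 1| * ‖ξ‖ ≤ ε / 8 * ‖ξ‖ := by gcongr
      linarith
    have hcos : 1 / 2 ≤ Real.cos (⟪x, ξ⟫ + (t - 1) * ‖ξ‖) := by
      refine le_trans ?_ Real.one_sub_sq_div_two_le_cos
      have := sq_le_sq' (neg_le_of_abs_le hθ) (le_of_abs_le hθ)
      linarith
    have hexp : Real.exp (-(3 / 2)) ≤ Real.exp (-ε * ‖ξ‖) := by
      gcongr
      linarith
    have hw := two_rpow_neg_abs_mul_le hε hε1 h1 h2 s
    calc _ = (2 ^ (-|s|) * ε ^ (-s)) * (Real.exp (-(3 / 2)) * m (ε • ξ)) * (1 / 2) := by ring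
      _ ≤ _ := by gcongr
  have hm_int : Integrable fun ξ : V n => m (ε • ξ) :=
    (hm.contDiff.continuous.integrable_of_hasCompactSupport hm.hasCompactSupport).comp_smul hε.ne'
  have hmono := integral_mono (hm_int.const_mul
    (1 / 2 * 2 ^ (-|s|) * Real.exp (-(3 / 2)) * ε ^ (-s))) hH_int.re hbound
  rw [integral_const_mul, integral_comp_smul_euclidean m hε] at hmono
  have hnorm : ∫ ξ, (H ξ).re ≤ ‖∫ ξ, H ξ‖ := by
    have h1 : ∫ ξ, (H ξ).re = (∫ ξ, H ξ).re := integral_re hH_int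
    rw [h1]
    exact Complex.re_le_norm _
  rw [invFT, norm_mul, Complex.norm_real, Real.norm_of_nonneg (by positivity), mul_assoc, mul_assoc,
    sub_eq_add_neg, Real.rpow_add hε]
  gcongr
  refine le_trans (le_of_eq ?_) (hmono.trans hnorm)
  ring

/-- The dispersive bound for the data. -/
lemma exists_norm_invFT_waveSymbol_le {n : ℕ} (hn : n ≠ 0) {m : V n → ℝ} (hm : IsAnnulusBump m) :
    ∃ C : ℝ, 0 < C ∧ ∀ ε : ℝ, 0 < ε → ε ≤ 1 → ∀ x : V n,
      ‖invFT (waveSymbol m ε 0 (ε + Complex.I)) x‖ ≤ C * ε ^ (-((n : ℝ) + 1) / 2) := by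
  obtain ⟨C, hC, hP⟩ := norm_poissonIntegral_le hn
  obtain ⟨G, hG⟩ : ∃ G : SchwartzMap (V n) ℂ, ∀ ξ, G ξ = ((m ξ : ℝ) : ℂ) :=
    ⟨(hm.hasCompactSupport.comp_left (g := ((↑) : ℝ → ℂ)) Complex.ofReal_zero).toSchwartzMap
      (Complex.ofRealCLM.contDiff.comp hm.contDiff), fun ξ => rfl⟩
  obtain ⟨φ, -, hφ, -⟩ := exists_schwartzMap_eq_invFT G
  refine ⟨((2 * Real.pi) ^ n)⁻¹ * (((∫ y, ‖φ y‖) + 1) * C), by positivity, fun ε hε hε1 x => ?_⟩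
  set τ : ℂ := ε + Complex.I with hτ
  have hτre : τ.re = ε := by simp [hτ]
  have hprod : Integrable (Function.uncurry fun (ξ y : V n) =>
      Complex.exp (Complex.I * ((⟪x - ε • y, ξ⟫ : ℝ) : ℂ)) * Complex.exp (-τ * (‖ξ‖ : ℂ)) * φ y)
      (volume.prod volume) := by
    refine ((integrable_exp_neg_mul_norm hn hε).mul_prod φ.integrable.norm).mono' ?_
      (ae_of_all _ fun z => ?_)
    · have := φ.continuous
      refine Continuous.aestronglyMeasurable ?_
      unfold Function.uncurry
      fun_prop
    · simp only [Function.uncurry]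
      rw [norm_mul, norm_mul, norm_exp_I_mul, norm_exp_neg_mul, one_mul, hτre]
  have hL : ∀ ξ : V n, ∫ y, Complex.exp (Complex.I * ((⟪x - ε • y, ξ⟫ : ℝ) : ℂ)) *
      Complex.exp (-τ * (‖ξ‖ : ℂ)) * φ y =
      Complex.exp (Complex.I * ((⟪x, ξ⟫ : ℝ) : ℂ)) * waveSymbol m ε 0 τ ξ := fun ξ => by
    rw [waveSymbol, ← hG, ← hφ, FT]
    simp only [zero_div, Real.rpow_zero, Complex.ofReal_one, one_mul]
    rw [← mul_assoc, ← integral_const_mul]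
    congr 1
    ext y
    rw [inner_sub_left, inner_smul_left, inner_smul_right, Complex.ofReal_sub, mul_sub,
      sub_eq_add_neg, Complex.exp_add]
    simp only [conj_trivial]
    ring
  have hR : ∀ y : V n, ∫ ξ, Complex.exp (Complex.I * ((⟪x - ε • y, ξ⟫ : ℝ) : ℂ)) *
      Complex.exp (-τ * (‖ξ‖ : ℂ)) * φ y = poissonIntegral (x - ε • y) τ * φ y := fun y => by
    rw [integral_mul_const, poissonIntegral]
  have hswap := integral_integral_swap hprod
  simp only [hL, hR] at hswap
  rw [invFT, hswap, norm_mul, Complex.norm_real, Real.norm_of_nonneg (by positivity), mul_assoc]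
  gcongr
  calc ‖∫ y, poissonIntegral (x - ε • y) τ * φ y‖
      ≤ ∫ y, C * ε ^ (-((n : ℝ) + 1) / 2) * ‖φ y‖ := by
        refine norm_integral_le_of_norm_le (φ.integrable.norm.const_mul _) (ae_of_all _ fun y => ?_)
        rw [norm_mul]
        gcongr
        exact hP ε hε hε1 _
    _ = (∫ y, ‖φ y‖) * C * ε ^ (-((n : ℝ) + 1) / 2) := by
        rw [integral_const_mul]
        ring
    _ ≤ _ := by
        gcongr
        linarith

lemma integral_norm_waveSymbol_sq_le {n : ℕ} {m : V n → ℝ} (hm : IsAnnulusBump m) {ε : ℝ}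
    (hε : 0 < ε) : ∫ ξ, ‖waveSymbol m ε 0 (ε + Complex.I) ξ‖ ^ 2 ≤ ε ^ (-(n : ℝ)) * ∫ ξ, m ξ := by
  rw [← integral_comp_smul_euclidean m hε]
  refine integral_mono_of_nonneg (ae_of_all _ fun ξ => by positivity)
    ((hm.contDiff.continuous.integrable_of_hasCompactSupport hm.hasCompactSupport).comp_smul hε.ne')
    (ae_of_all _ fun ξ => ?_)
  have h0 := hm.nonneg (ε • ξ)
  have h1 := hm.le_one (ε • ξ)
  have h2 : Real.exp (-ε * ‖ξ‖) ≤ 1 := Real.exp_le_one_iff.2 (by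
    have := norm_nonneg ξ
    nlinarith)
  have h3 : ‖waveSymbol m ε 0 (ε + Complex.I) ξ‖ = Real.exp (-ε * ‖ξ‖) * m (ε • ξ) := by
    rw [waveSymbol, norm_mul, norm_mul, norm_exp_neg_mul, Complex.norm_real, Complex.norm_real,
      Real.norm_of_nonneg h0]
    simp
  simp only [h3]
  have h4 : Real.exp (-ε * ‖ξ‖) * m (ε • ξ) ≤ m (ε • ξ) := mul_le_of_le_one_left h0 h2
  have h5 : 0 ≤ Real.exp (-ε * ‖ξ‖) * m (ε • ξ) := by positivity
  nlinarith

/-- Interpolation of `L^p` between `L²` and `L^∞`. -/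
lemma lintegral_enorm_rpow_le {n : ℕ} (f : SchwartzMap (V n) ℂ) {p A B : ℝ} (hp : 2 < p)
    (hA : ∀ x, ‖f x‖ ≤ A) (hB : ∫ x, ‖f x‖ ^ 2 ≤ B) :
    ∫⁻ x, ‖f x‖ₑ ^ p ≤ ENNReal.ofReal (A ^ (p - 2) * B) := by
  have hA0 : 0 ≤ A := (norm_nonneg _).trans (hA 0)
  have hint : Integrable fun x => A ^ (p - 2) * ‖f x‖ ^ 2 :=
    ((f.memLp 2 volume).integrable_norm_pow two_ne_zero).const_mul _
  calc ∫⁻ x, ‖f x‖ₑ ^ p ≤ ∫⁻ x, ENNReal.ofReal (A ^ (p - 2) * ‖f x‖ ^ 2) := by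
        refine lintegral_mono fun x => ?_
        rw [← ofReal_norm, ENNReal.ofReal_rpow_of_nonneg (norm_nonneg _) (by linarith)]
        refine ENNReal.ofReal_le_ofReal ?_
        calc ‖f x‖ ^ p = ‖f x‖ ^ (p - 2) * ‖f x‖ ^ 2 := by
              rw [← Real.rpow_two, ← Real.rpow_add_of_nonneg (norm_nonneg _) (by linarith)
                (by norm_num)]
              congr 1
              ring
          _ ≤ _ := by
              gcongr
              exact hA x
    _ = ENNReal.ofReal (∫ x, A ^ (p - 2) * ‖f x‖ ^ 2) :=
        (ofReal_integral_eq_lintegral_ofReal hint (ae_of_all _ fun x => by positivity)).symm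
    _ ≤ _ := by
        rw [integral_const_mul]
        gcongr

lemma eLpNorm_ofReal_rpow {n : ℕ} (f : V n → ℂ) {p : ℝ} (hp : 0 < p) :
    eLpNorm f (ENNReal.ofReal p) volume ^ p = ∫⁻ x, ‖f x‖ₑ ^ p := by
  rw [eLpNorm_eq_lintegral_rpow_enorm_toReal (by simpa using hp) ENNReal.ofReal_ne_top,
    ENNReal.toReal_ofReal hp.le, ← ENNReal.rpow_mul, one_div_mul_cancel hp.ne', ENNReal.rpow_one]

lemma ofReal_le_lintegral_enorm_rpow {n : ℕ} {g : V n → ℂ} {p a r : ℝ} (hp : 0 < p) (ha : 0 ≤ a)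
    (hr : 0 ≤ r) (hg : ∀ x, ‖x‖ ≤ r → a ≤ ‖g x‖) :
    ENNReal.ofReal (a ^ p * (r ^ n * volume.real (Metric.ball (0 : V n) 1))) ≤
      ∫⁻ x, ‖g x‖ₑ ^ p := by
  have hvol : volume (Metric.closedBall (0 : V n) r) =
      ENNReal.ofReal (r ^ n * volume.real (Metric.ball (0 : V n) 1)) := by
    rw [Measure.addHaar_closedBall _ _ hr, finrank_euclideanSpace_fin,
      ENNReal.ofReal_mul (by positivity), ofReal_measureReal measure_ball_lt_top.ne]
  calc _ = ∫⁻ _ in Metric.closedBall (0 : V n) r, ENNReal.ofReal (a ^ p) := by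
        rw [setLIntegral_const, hvol, ENNReal.ofReal_mul (by positivity)]
    _ ≤ ∫⁻ x in Metric.closedBall (0 : V n) r, ‖g x‖ₑ ^ p := by
        refine setLIntegral_mono' measurableSet_closedBall fun x hx => ?_
        rw [← ofReal_norm, ENNReal.ofReal_rpow_of_nonneg (norm_nonneg _) hp.le]
        refine ENNReal.ofReal_le_ofReal (Real.rpow_le_rpow ha (hg x ?_) hp.le)
        simpa using hx
    _ ≤ _ := setLIntegral_le_lintegral _ _

lemma not_forall_rpow_le {a K : ℝ} (ha : a < 0) : ¬ ∀ ε : ℝ, 0 < ε → ε ≤ 1 → ε ^ a ≤ K := by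
  intro h
  have hlim := tendsto_rpow_neg_nhdsGT_zero ha
  have h1 := hlim.eventually_gt_atTop K
  have h2 : ∀ᶠ ε : ℝ in nhdsWithin 0 (Set.Ioi 0), ε ∈ Set.Ioc (0 : ℝ) 1 :=
    Ioc_mem_nhdsGT one_pos
  obtain ⟨ε, hε, hε0, hε1⟩ := (h1.and h2).exists
  exact absurd (h ε hε0 hε1) (not_le.2 hε)

/-- in the local smoothing conjecture for `e^{it√(−Δ)}` the regularity
gain `1/p` cannot be replaced by any larger number: for `n ≥ 2`, `2 < p < ∞` and any
`σ > 1/p` there is no constant `C` with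
`(∫₁² ‖⟨D⟩^{σ−s̄_p} e^{it√(−Δ)}f‖_{L^p}^p dt)^{1/p} ≤ C‖f‖_{L^p}` for all Schwartz `f`. -/
theorem local_smoothing_gain_sharp (n : ℕ) (hn : 2 ≤ n) (p : ℝ) (hp : 2 < p) :
    ∀ σ : ℝ, 1 / p < σ →
      ¬ ∃ C : ℝ, ∀ f : SchwartzMap (V n) ℂ,
        (∫⁻ t in Set.Icc (1 : ℝ) 2,
            (eLpNorm (besselD (σ - sBar n p) (halfWave t ⇑f)) (ENNReal.ofReal p) volume)
              ^ p) ^ (1 / p)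
          ≤ ENNReal.ofReal C * eLpNorm (⇑f) (ENNReal.ofReal p) volume := by
  rintro σ hσ ⟨C, hC⟩
  have hn0 : n ≠ 0 := by omega
  have hp0 : 0 < p := by linarith
  obtain ⟨m, hm⟩ := exists_isAnnulusBump hn0
  set s : ℝ := σ - sBar n p with hs
  obtain ⟨c, hc, hlow⟩ := exists_le_norm_invFT_waveSymbol hm s
  obtain ⟨D, hD, hup⟩ := exists_norm_invFT_waveSymbol_le hn0 hm
  have hI := hm.integral_pos
  set κ : ℝ := volume.real (Metric.ball (0 : V n) 1) with hκ
  have hκ0 : 0 < κ := by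
    rw [hκ, measureReal_def]
    exact ENNReal.toReal_pos (Metric.measure_ball_pos _ _ one_pos).ne' measure_ball_lt_top.ne
  have hσp : 1 - σ * p < 0 := by
    rw [div_lt_iff₀ hp0] at hσ
    linarith
  have hsp : s * p = σ * p - (n - 1) * (p / 2 - 1) := by
    have : 1 / p ≤ 1 / 2 := one_div_le_one_div_of_le two_pos hp.le
    rw [hs, sBar, abs_of_nonneg (by linarith)]
    field_simp
  set c₁ : ℝ := c ^ p * ((1 / 8) ^ n * κ) * (1 / 8) with hc₁
  set c₂ : ℝ := (max C 0) ^ p * (D ^ (p - 2) * (((2 * Real.pi) ^ n)⁻¹ * ∫ ξ, m ξ)) with hc₂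
  have hc₁0 : 0 < c₁ := by positivity
  refine not_forall_rpow_le (K := c₂ / c₁) hσp fun ε hε hε1 => ?_
  obtain ⟨G, hG⟩ := exists_schwartzMap_eq_waveSymbol hm hε 0 (ε + Complex.I)
  obtain ⟨f, hf, hFT, hL2⟩ := exists_schwartzMap_eq_invFT G
  rw [hG] at hf hFT hL2
  have hfp : eLpNorm (⇑f) (ENNReal.ofReal p) volume ^ p ≤ ENNReal.ofReal
      ((D * ε ^ (-((n : ℝ) + 1) / 2)) ^ (p - 2) *
        (((2 * Real.pi) ^ n)⁻¹ * (ε ^ (-(n : ℝ)) * ∫ ξ, m ξ))) := by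
    rw [eLpNorm_ofReal_rpow _ hp0]
    refine lintegral_enorm_rpow_le f hp (fun x => ?_) ?_
    · rw [hf]
      exact hup ε hε hε1 x
    · rw [hL2]
      gcongr
      exact integral_norm_waveSymbol_sq_le hm hε
  have hlow' : ∀ t ∈ Set.Icc (1 : ℝ) (1 + ε / 8),
      ENNReal.ofReal ((c * ε ^ (-s - n)) ^ p * ((ε / 8) ^ n * κ)) ≤
        eLpNorm (besselD s (halfWave t ⇑f)) (ENNReal.ofReal p) volume ^ p := fun t ht => by
    rw [eLpNorm_ofReal_rpow _ hp0, besselD_halfWave_eq_invFT hm hε hFT]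
    refine ofReal_le_lintegral_enorm_rpow hp0 (by positivity) (by positivity)
      (hlow ε hε hε1 t ?_)
    rw [abs_of_nonneg (by linarith [ht.1])]
    linarith [ht.2]
  have hleft : ENNReal.ofReal ((c * ε ^ (-s - n)) ^ p * ((ε / 8) ^ n * κ) * (ε / 8)) ≤
      ∫⁻ t in Set.Icc (1 : ℝ) 2,
        eLpNorm (besselD s (halfWave t ⇑f)) (ENNReal.ofReal p) volume ^ p := by
    calc _ = ∫⁻ _ in Set.Icc (1 : ℝ) (1 + ε / 8),
          ENNReal.ofReal ((c * ε ^ (-s - n)) ^ p * ((ε / 8) ^ n * κ)) := by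
          rw [setLIntegral_const, Real.volume_Icc, add_sub_cancel_left,
            ENNReal.ofReal_mul (by positivity)]
      _ ≤ ∫⁻ t in Set.Icc (1 : ℝ) (1 + ε / 8),
          eLpNorm (besselD s (halfWave t ⇑f)) (ENNReal.ofReal p) volume ^ p :=
          setLIntegral_mono' measurableSet_Icc hlow'
      _ ≤ _ := lintegral_mono_set (Set.Icc_subset_Icc_right (by linarith))
  have hCmax : ENNReal.ofReal C = ENNReal.ofReal (max C 0) := by simp
  have hmain := ENNReal.rpow_le_rpow (hC f) hp0.le
  rw [← ENNReal.rpow_mul, one_div_mul_cancel hp0.ne', ENNReal.rpow_one,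
    ENNReal.mul_rpow_of_nonneg _ _ hp0.le, hCmax,
    ENNReal.ofReal_rpow_of_nonneg (le_max_right _ _) hp0.le] at hmain
  have hreal := hleft.trans (hmain.trans (mul_le_mul_right hfp _))
  rw [← ENNReal.ofReal_mul (by positivity), ENNReal.ofReal_le_ofReal_iff (by positivity)] at hreal
  have hl : (c * ε ^ (-s - n)) ^ p * ((ε / 8) ^ n * κ) * (ε / 8) =
      c₁ * ε ^ ((-s - n) * p + n + 1) := by
    rw [Real.mul_rpow hc.le (by positivity), ← Real.rpow_mul hε.le, Real.rpow_add hε,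
      Real.rpow_add hε, Real.rpow_one, Real.rpow_natCast, hc₁, div_pow, div_pow, one_pow]
    ring
  have hr : (max C 0) ^ p * ((D * ε ^ (-((n : ℝ) + 1) / 2)) ^ (p - 2) *
        (((2 * Real.pi) ^ n)⁻¹ * (ε ^ (-(n : ℝ)) * ∫ ξ, m ξ))) =
      c₂ * ε ^ (-((n : ℝ) + 1) / 2 * (p - 2) - n) := by
    rw [Real.mul_rpow hD.le (by positivity), ← Real.rpow_mul hε.le, sub_eq_add_neg _ (n : ℝ),
      Real.rpow_add hε, hc₂]
    ring
  have hexp : (-s - n) * p + n + 1 =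
      (1 - σ * p) + (-((n : ℝ) + 1) / 2 * (p - 2) - n) := by
    linear_combination -hsp
  rw [hl, hr, hexp, Real.rpow_add hε, ← mul_assoc] at hreal
  rw [le_div_iff₀ hc₁0, mul_comm]
  exact le_of_mul_le_mul_right hreal (by positivity)
end
end

section
/- Let n ≥ 2. For every ε > 0 there is a constant C such that for all f in the Schwartz class S(ℝⁿ) and all t ∈ [1,2], ‖⟨D⟩^{−(n−1)/2−ε} e^{it√(−Δ)} f‖_{L^∞(ℝⁿ)} ≤ C‖f‖_{L^∞(ℝⁿ)}. -/
open MeasureTheory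
open scoped RealInnerProductSpace ENNReal

noncomputable section

/-- The unnormalised inverse Fourier transform `x ↦ ∫ e^{i⟨x,ξ⟩} F(ξ) dξ`. -/
def synth {n : ℕ} (F : V n → ℂ) (x : V n) : ℂ :=
  ∫ ξ : V n, Complex.exp (Complex.I * ((⟪x, ξ⟫ : ℝ) : ℂ)) * F ξ

lemma norm_exp_I_mul_ofReal_mul (a : ℝ) (z : ℂ) :
    ‖Complex.exp (Complex.I * (a : ℂ)) * z‖ = ‖z‖ := by
  rw [norm_mul, mul_comm Complex.I, Complex.norm_exp_ofReal_mul_I, one_mul]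

lemma integrable_exp_mul {n : ℕ} {F : V n → ℂ} (hF : Integrable F) (x : V n) :
    Integrable fun ξ : V n => Complex.exp (Complex.I * ((⟪x, ξ⟫ : ℝ) : ℂ)) * F ξ := by
  refine hF.mono ?_ (.of_forall fun ξ => (norm_exp_I_mul_ofReal_mul _ _).le)
  exact (Continuous.aestronglyMeasurable (by fun_prop)).mul hF.aestronglyMeasurable

/-- `m` is a Fourier multiplier on `L^∞` with norm at most `C`, expressed on functions with
integrable Fourier transform. -/
structure SupMultiplier {n : ℕ} (m : V n → ℂ) (C : ℝ) : Prop where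
  measurable : Measurable m
  norm_le : ∀ ξ, ‖m ξ‖ ≤ C
  norm_synth_le : ∀ F : V n → ℂ, Integrable F → ∀ S : ℝ, (∀ x, ‖synth F x‖ ≤ S) →
    ∀ x, ‖synth (fun ξ => m ξ * F ξ) x‖ ≤ C * S

namespace SupMultiplier

variable {n : ℕ} {m m₁ m₂ : V n → ℂ} {C C₁ C₂ : ℝ}

lemma nonneg (h : SupMultiplier m C) : 0 ≤ C := (norm_nonneg _).trans (h.norm_le 0)

lemma mono (h : SupMultiplier m C₁) (hC : C₁ ≤ C₂) : SupMultiplier m C₂ where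
  measurable := h.measurable
  norm_le ξ := (h.norm_le ξ).trans hC
  norm_synth_le F hF S hS x := (h.norm_synth_le F hF S hS x).trans
    (mul_le_mul_of_nonneg_right hC ((norm_nonneg _).trans (hS 0)))

lemma integrable_mul (h : SupMultiplier m C) {F : V n → ℂ} (hF : Integrable F) :
    Integrable fun ξ => m ξ * F ξ :=
  hF.bdd_mul h.measurable.aestronglyMeasurable (.of_forall h.norm_le)

lemma const (c : ℂ) : SupMultiplier (fun _ : V n => c) ‖c‖ where
  measurable := measurable_const
  norm_le _ := le_rfl
  norm_synth_le F _ S hS x := by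
    have : synth (fun ξ => c * F ξ) x = c * synth F x := by
      simp only [synth, mul_left_comm _ c, integral_const_mul]
    rw [this, norm_mul]
    exact mul_le_mul_of_nonneg_left (hS x) (norm_nonneg _)

lemma add (h₁ : SupMultiplier m₁ C₁) (h₂ : SupMultiplier m₂ C₂) :
    SupMultiplier (fun ξ => m₁ ξ + m₂ ξ) (C₁ + C₂) where
  measurable := h₁.measurable.add h₂.measurable
  norm_le ξ := (norm_add_le _ _).trans (add_le_add (h₁.norm_le ξ) (h₂.norm_le ξ))
  norm_synth_le F hF S hS x := by
    have : synth (fun ξ => (m₁ ξ + m₂ ξ) * F ξ) x =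
        synth (fun ξ => m₁ ξ * F ξ) x + synth (fun ξ => m₂ ξ * F ξ) x := by
      simp only [synth, add_mul, mul_add]
      exact integral_add (integrable_exp_mul (h₁.integrable_mul hF) x)
        (integrable_exp_mul (h₂.integrable_mul hF) x)
    rw [this, add_mul]
    exact (norm_add_le _ _).trans
      (add_le_add (h₁.norm_synth_le F hF S hS x) (h₂.norm_synth_le F hF S hS x))

lemma mul (h₁ : SupMultiplier m₁ C₁) (h₂ : SupMultiplier m₂ C₂) :
    SupMultiplier (fun ξ => m₁ ξ * m₂ ξ) (C₁ * C₂) where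
  measurable := h₁.measurable.mul h₂.measurable
  norm_le ξ := by
    rw [norm_mul]
    exact mul_le_mul (h₁.norm_le ξ) (h₂.norm_le ξ) (norm_nonneg _) h₁.nonneg
  norm_synth_le F hF S hS x := by
    simpa only [mul_assoc] using h₁.norm_synth_le _ (h₂.integrable_mul hF) _
      (h₂.norm_synth_le F hF S hS) x

lemma const_mul (h : SupMultiplier m C) (c : ℂ) :
    SupMultiplier (fun ξ => c * m ξ) (‖c‖ * C) := (const c).mul h

lemma pow (h : SupMultiplier m C) (k : ℕ) : SupMultiplier (fun ξ => m ξ ^ k) (C ^ k) := by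
  induction k with
  | zero => simpa using const (n := n) 1
  | succ k ih => simpa only [pow_succ] using ih.mul h

/-- Superpositions of multipliers are multipliers. -/
lemma integral {α : Type*} [MeasurableSpace α] {μ : Measure α} [SFinite μ]
    {m : α → V n → ℂ} {c : α → ℝ} (hm : Measurable (Function.uncurry m))
    (hc : Integrable c μ) (h : ∀ᵐ a ∂μ, SupMultiplier (m a) (c a)) :
    SupMultiplier (fun ξ => ∫ a, m a ξ ∂μ) (∫ a, c a ∂μ) where
  measurable := by
    have : Measurable (Function.uncurry fun ξ a => m a ξ) := hm.comp measurable_swap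
    exact this.stronglyMeasurable.integral_prod_right'.measurable
  norm_le ξ := norm_integral_le_of_norm_le hc (h.mono fun a ha => ha.norm_le ξ)
  norm_synth_le F hF S hS x := by
    have key : synth (fun ξ => (∫ a, m a ξ ∂μ) * F ξ) x =
        ∫ a, synth (fun ξ => m a ξ * F ξ) x ∂μ := by
      simp only [synth]
      rw [integral_integral_swap]
      · refine integral_congr_ae (.of_forall fun ξ => ?_)
        simp only
        rw [integral_const_mul, integral_mul_const]
      · have hcF : Integrable (fun p : α × V n => c p.1 * ‖F p.2‖) (μ.prod volume) :=
          hc.mul_prod hF.norm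
        refine hcF.mono' ?_ ?_
        · refine AEStronglyMeasurable.mul (Continuous.comp_aestronglyMeasurable
            (g := fun ξ : V n => Complex.exp (Complex.I * ((⟪x, ξ⟫ : ℝ) : ℂ))) (by fun_prop)
            measurable_snd.aestronglyMeasurable) ?_
          exact hm.aestronglyMeasurable.mul hF.aestronglyMeasurable.comp_snd
        · have h' : ∀ᵐ p ∂μ.prod (volume : Measure (V n)), SupMultiplier (m p.1) (c p.1) :=
            Measure.quasiMeasurePreserving_fst.ae h
          filter_upwards [h'] with p hp
          simp only [Function.uncurry]
          rw [norm_exp_I_mul_ofReal_mul, norm_mul]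
          exact mul_le_mul_of_nonneg_right (hp.norm_le _) (norm_nonneg _)
    rw [key, ← integral_mul_const]
    exact norm_integral_le_of_norm_le (hc.mul_const S)
      (h.mono fun a ha => ha.norm_synth_le F hF S hS x)

/-- The Fourier transform of an integrable kernel is a multiplier. -/
lemma of_kernel {K : V n → ℂ} (hK : Integrable K) : SupMultiplier (FT K) (∫ y, ‖K y‖) where
  measurable := by
    have h : Measurable fun p : V n × V n =>
        Complex.exp (-(Complex.I * ((⟪p.2, p.1⟫ : ℝ) : ℂ))) * hK.1.mk K p.2 :=
      Measurable.mul (Continuous.measurable (by fun_prop))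
        (hK.1.stronglyMeasurable_mk.measurable.comp measurable_snd)
    convert (h.stronglyMeasurable.integral_prod_right' (ν := volume)).measurable using 1
    ext ξ
    refine integral_congr_ae ?_
    filter_upwards [hK.1.ae_eq_mk] with y hy
    rw [hy]
  norm_le ξ := by
    refine norm_integral_le_of_norm_le hK.norm (.of_forall fun y => ?_)
    rw [← mul_neg, ← Complex.ofReal_neg, norm_exp_I_mul_ofReal_mul]
  norm_synth_le F hF S hS x := by
    have key : synth (fun ξ => FT K ξ * F ξ) x = ∫ y, K y * synth F (x - y) := by
      simp only [synth, FT, ← integral_const_mul, ← integral_mul_const]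
      rw [integral_integral_swap]
      · refine integral_congr_ae (.of_forall fun ξ => integral_congr_ae (.of_forall fun y => ?_))
        simp only [inner_sub_left]
        rw [Complex.ofReal_sub, mul_sub, sub_eq_add_neg, Complex.exp_add]
        ring
      · refine ((hF.norm.mul_prod hK.norm)).mono' ?_ (.of_forall fun p => ?_)
        · refine AEStronglyMeasurable.mul (Continuous.aestronglyMeasurable (by fun_prop)) ?_
          refine AEStronglyMeasurable.mul (AEStronglyMeasurable.mul
            (Continuous.aestronglyMeasurable (by fun_prop)) ?_) ?_
          · exact hK.aestronglyMeasurable.comp_snd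
          · exact hF.aestronglyMeasurable.comp_fst
        · simp only [Function.uncurry]
          rw [norm_exp_I_mul_ofReal_mul, norm_mul, ← mul_neg, ← Complex.ofReal_neg,
            norm_exp_I_mul_ofReal_mul, mul_comm]
    rw [key, ← integral_mul_const]
    refine norm_integral_le_of_norm_le (hK.norm.mul_const S) (.of_forall fun y => ?_)
    rw [norm_mul]
    exact mul_le_mul_of_nonneg_left (hS _) (norm_nonneg _)

end SupMultiplier

lemma image_sub_div_Ioi {c : ℝ} (hc : 0 < c) :
    (fun r : ℝ => r - c / r) '' Set.Ioi 0 = Set.univ := by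
  refine Set.eq_univ_of_forall fun u => ?_
  have h1 : |u| < √(u ^ 2 + 4 * c) := Real.lt_sqrt_of_sq_lt (by rw [sq_abs]; linarith)
  have h2 : √(u ^ 2 + 4 * c) ^ 2 = u ^ 2 + 4 * c := Real.sq_sqrt (by positivity)
  have h3 : 0 < (u + √(u ^ 2 + 4 * c)) / 2 := by linarith [neg_abs_le u]
  refine ⟨(u + √(u ^ 2 + 4 * c)) / 2, h3, ?_⟩
  have : u + √(u ^ 2 + 4 * c) ≠ 0 := by linarith
  simp only
  field_simp
  linear_combination h2

lemma injOn_sub_div_Ioi {c : ℝ} (hc : 0 < c) :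
    Set.InjOn (fun r : ℝ => r - c / r) (Set.Ioi 0) := by
  intro a ha b hb hab
  have ha' : 0 < a := ha
  have hb' : 0 < b := hb
  simp only at hab
  field_simp at hab
  have : (a - b) * (a * b + c) = 0 := by linear_combination hab
  rcases mul_eq_zero.mp this with h | h
  · linarith
  · nlinarith [mul_pos ha' hb']

lemma hasDerivWithinAt_sub_div {c x : ℝ} (hx : x ∈ Set.Ioi (0 : ℝ)) :
    HasDerivWithinAt (fun r : ℝ => r - c / r) (1 + c / x ^ 2) (Set.Ioi 0) x := by
  have h := (hasDerivAt_id x).sub ((hasDerivAt_inv (ne_of_gt hx)).const_mul c)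
  refine (h.congr_deriv ?_).hasDerivWithinAt
  ring

lemma hasDerivWithinAt_div {c x : ℝ} (hx : x ∈ Set.Ioi (0 : ℝ)) :
    HasDerivWithinAt (fun r : ℝ => c / r) (-(c / x ^ 2)) (Set.Ioi 0) x := by
  have h := ((hasDerivAt_inv (ne_of_gt hx)).const_mul c)
  refine (h.congr_deriv ?_).hasDerivWithinAt
  ring

/-- The Cauchy–Schlömilch substitution. -/
lemma integral_comp_sub_div_Ioi {c : ℝ} (hc : 0 < c) {g : ℝ → ℂ} (hg : Integrable g)
    (hcont : Continuous g) (heven : ∀ u, g (-u) = g u) :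
    ∫ r in Set.Ioi (0 : ℝ), g (r - c / r) = (1 / 2) * ∫ u, g u := by
  have hpos : ∀ x ∈ Set.Ioi (0 : ℝ), |1 + c / x ^ 2| = 1 + c / x ^ 2 := fun x hx =>
    abs_of_pos (by have : 0 < x := hx; positivity)
  have hint : IntegrableOn (fun r => (1 + c / r ^ 2) • g (r - c / r)) (Set.Ioi 0) := by
    have h := (integrableOn_image_iff_integrableOn_abs_deriv_smul measurableSet_Ioi
      (fun x hx => hasDerivWithinAt_sub_div (c := c) hx) (injOn_sub_div_Ioi hc) g).1 (by
        rw [image_sub_div_Ioi hc]; exact hg.integrableOn)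
    refine h.congr_fun (fun x hx => ?_) measurableSet_Ioi
    simp only [hpos x hx]
  have hmeas : AEStronglyMeasurable (fun r : ℝ => g (r - c / r)) (volume.restrict (Set.Ioi 0)) :=
    (hcont.measurable.comp (by fun_prop)).aestronglyMeasurable
  have hint₁ : IntegrableOn (fun r => g (r - c / r)) (Set.Ioi 0) := by
    refine Integrable.mono hint hmeas ?_
    refine (ae_restrict_mem measurableSet_Ioi).mono fun x hx => ?_
    rw [norm_smul, Real.norm_eq_abs, hpos x hx]
    have : 0 < x := hx
    exact le_mul_of_one_le_left (norm_nonneg _) (by have : 0 ≤ c / x ^ 2 := by positivity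
                                                    linarith)
  have hint₂ : IntegrableOn (fun r => (c / r ^ 2) • g (r - c / r)) (Set.Ioi 0) := by
    refine (hint.sub hint₁).congr (.of_forall fun x => ?_)
    simp only [Pi.sub_apply, add_smul, one_smul, add_sub_cancel_left]
  have hfull : ∫ u, g u = ∫ r in Set.Ioi (0 : ℝ), (1 + c / r ^ 2) • g (r - c / r) := by
    rw [← setIntegral_univ, ← image_sub_div_Ioi hc,
      integral_image_eq_integral_abs_deriv_smul measurableSet_Ioi
      (fun x hx => hasDerivWithinAt_sub_div (c := c) hx) (injOn_sub_div_Ioi hc)]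
    exact setIntegral_congr_fun measurableSet_Ioi fun x hx => by simp only [hpos x hx]
  have himage : (fun r : ℝ => c / r) '' Set.Ioi 0 = Set.Ioi 0 := by
    ext y
    constructor
    · rintro ⟨x, hx, rfl⟩
      exact div_pos hc hx
    · intro hy
      have hy' : 0 < y := hy
      exact ⟨c / y, div_pos hc hy, by field_simp⟩
  have hinv : ∫ r in Set.Ioi (0 : ℝ), g (r - c / r) =
      ∫ r in Set.Ioi (0 : ℝ), (c / r ^ 2) • g (r - c / r) := by
    conv_lhs => rw [← himage]
    rw [integral_image_eq_integral_abs_deriv_smul measurableSet_Ioi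
      (fun x hx => hasDerivWithinAt_div (c := c) hx)]
    · refine setIntegral_congr_fun measurableSet_Ioi fun x hx => ?_
      have hx' : 0 < x := hx
      rw [abs_neg, abs_of_pos (by positivity), ← heven]
      congr 2
      field_simp
      ring
    · intro a ha b hb hab
      have ha' : 0 < a := ha
      have hb' : 0 < b := hb
      simp only at hab
      field_simp at hab
      exact hab.symm
  have hsum : ∫ r in Set.Ioi (0 : ℝ), (1 + c / r ^ 2) • g (r - c / r) =
      (∫ r in Set.Ioi (0 : ℝ), g (r - c / r)) +
        ∫ r in Set.Ioi (0 : ℝ), (c / r ^ 2) • g (r - c / r) := by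
    rw [← integral_add hint₁ hint₂]
    simp only [add_smul, one_smul]
  rw [hfull, hsum, ← hinv]
  ring

/-- Subordination of `e^{-2cz}` to Gaussians in `c`, for complex `z`. -/
lemma integral_exp_neg_mul_sq_add_div_sq {z : ℂ} (hz : 0 < z.re) {c : ℝ} (hc : 0 ≤ c) :
    ∫ r in Set.Ioi (0 : ℝ), Complex.exp (-z * ((r ^ 2 + c ^ 2 / r ^ 2 : ℝ) : ℂ)) =
      (1 / 2) * (Real.pi / z) ^ (1 / 2 : ℂ) * Complex.exp (-(2 * c * z)) := by
  rcases hc.eq_or_lt with rfl | hc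
  · have h := integral_gaussian_complex_Ioi hz
    simp only [ne_eq, OfNat.ofNat_ne_zero, not_false_eq_true, zero_pow, zero_div, add_zero,
      Complex.ofReal_pow, Complex.ofReal_zero, mul_zero, zero_mul, neg_zero, Complex.exp_zero,
      mul_one]
    rw [h]
    ring
  · have h := integral_comp_sub_div_Ioi hc (g := fun u : ℝ => Complex.exp (-z * (u : ℂ) ^ 2))
      (integrable_cexp_neg_mul_sq hz) (by fun_prop) (by simp)
    rw [integral_gaussian_complex hz] at h
    rw [← h, ← integral_mul_const]
    refine setIntegral_congr_fun measurableSet_Ioi fun r hr => ?_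
    have hr' : (r : ℂ) ≠ 0 := by exact_mod_cast (ne_of_gt hr)
    rw [← Complex.exp_add]
    congr 1
    push_cast
    field_simp
    ring

lemma cpow_div_sq {w : ℂ} (hw : w ≠ 0) {r : ℝ} (hr : 0 < r) (n : ℕ) :
    (w / (r : ℂ) ^ 2) ^ ((n : ℂ) / 2) = w ^ ((n : ℂ) / 2) * ((r : ℂ) ^ n)⁻¹ := by
  have hr' : (r : ℂ) ≠ 0 := by exact_mod_cast hr.ne'
  have h2 : (0 : ℝ) < (r ^ 2)⁻¹ := by positivity
  have h1 : w / (r : ℂ) ^ 2 = (((r ^ 2)⁻¹ : ℝ) : ℂ) * w := by push_cast; field_simp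
  have h3 : (r : ℂ) ^ n = Complex.exp (n * (Real.log r : ℂ)) := by
    rw [Complex.exp_nat_mul, ← Complex.ofReal_exp, Real.exp_log hr]
  rw [h1, Complex.cpow_def_of_ne_zero (mul_ne_zero (by exact_mod_cast h2.ne') hw),
    Complex.cpow_def_of_ne_zero hw, Complex.log_ofReal_mul h2 hw, h3, ← Complex.exp_neg,
    ← Complex.exp_add, Real.log_inv, Real.log_pow]
  congr 1
  push_cast
  ring

lemma FT_gaussian {n : ℕ} {z : ℂ} (hz : 0 < z.re) {r : ℝ} (hr : 0 < r) (ξ : V n) :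
    FT (fun y : V n => Complex.exp (-((r : ℂ) ^ 2 / z) * (‖y‖ : ℂ) ^ 2)) ξ =
      (Real.pi * z) ^ ((n : ℂ) / 2) * ((r : ℂ) ^ n)⁻¹ *
        Complex.exp (-z * ((‖ξ‖ / 2) ^ 2 / r ^ 2 : ℝ)) := by
  have hz0 : z ≠ 0 := by rintro rfl; simp at hz
  have hr' : (r : ℂ) ≠ 0 := by exact_mod_cast hr.ne'
  have hb : 0 < ((r : ℂ) ^ 2 / z).re := by
    rw [← Complex.ofReal_pow, Complex.div_re]
    simp only [Complex.ofReal_re, Complex.ofReal_im, zero_mul, zero_div, add_zero]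
    have := Complex.normSq_pos.2 hz0
    positivity
  have h := GaussianFourier.integral_cexp_neg_mul_sq_norm_add (V := V n) hb (-Complex.I) ξ
  rw [finrank_euclideanSpace_fin] at h
  have h1 : (Real.pi : ℂ) / ((r : ℂ) ^ 2 / z) = Real.pi * z / (r : ℂ) ^ 2 := by field_simp
  rw [h1, cpow_div_sq (mul_ne_zero (by exact_mod_cast Real.pi_ne_zero) hz0) hr] at h
  rw [FT]
  convert h using 1
  · refine integral_congr_ae (.of_forall fun y => ?_)
    simp only
    rw [← Complex.exp_add, real_inner_comm]
    congr 1
    ring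
  · congr 2
    push_cast
    rw [neg_sq, Complex.I_sq]
    field_simp
    ring

lemma exists_norm_integral_pow_mul_exp_neg_mul_sq (n : ℕ) : ∃ c : ℝ, ∀ w : ℂ, 0 < w.re →
    ‖∫ r in Set.Ioi (0 : ℝ), (r : ℂ) ^ n * Complex.exp (-w * (r : ℂ) ^ 2)‖ =
      c * ‖w‖ ^ (-(((n : ℝ) + 1) / 2)) := by
  set v : ℝ := (volume : Measure (V (n + 1))).real (Metric.ball 0 1) with hv
  have hv0 : 0 < v := ENNReal.toReal_pos (Metric.measure_ball_pos _ _ one_pos).ne'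
    measure_ball_lt_top.ne
  refine ⟨(((n : ℝ) + 1) * v)⁻¹ * Real.pi ^ (((n : ℝ) + 1) / 2), fun w hw => ?_⟩
  have h1 := GaussianFourier.integral_cexp_neg_mul_sq_norm (V := V (n + 1)) hw
  have h2 := integral_fun_norm_addHaar (volume : Measure (V (n + 1)))
    (fun r : ℝ => Complex.exp (-w * (r : ℂ) ^ 2))
  rw [h1, finrank_euclideanSpace_fin, ← hv] at h2
  have h3 := congrArg norm h2
  have hw0 : 0 < ‖w‖ := norm_pos_iff.2 (by rintro rfl; simp at hw)
  have h4 : ((n + 1 : ℕ) : ℂ) / 2 = ((((n : ℝ) + 1) / 2 : ℝ) : ℂ) := by push_cast; ring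
  rw [h4, Complex.norm_cpow_real, norm_div, Complex.norm_real, Real.norm_of_nonneg Real.pi_pos.le,
    nsmul_eq_mul, norm_mul, norm_smul, Real.norm_of_nonneg hv0.le, Complex.norm_natCast,
    Real.div_rpow Real.pi_pos.le hw0.le] at h3
  simp only [Nat.add_sub_cancel, Complex.real_smul, Complex.ofReal_pow] at h3
  push_cast at h3
  rw [Real.rpow_neg hw0.le]
  generalize ‖∫ r in Set.Ioi (0 : ℝ), (r : ℂ) ^ n * Complex.exp (-w * (r : ℂ) ^ 2)‖ = J at h3 ⊢
  have : (0 : ℝ) < n + 1 := by positivity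
  field_simp
  rw [div_eq_iff (by positivity)] at h3
  rw [h3]
  ring

/-- The Poisson multiplier at complex time, with the `L¹` norm of its kernel. -/
lemma supMultiplier_exp_neg_mul_norm_aux {n : ℕ} {z : ℂ} (hz : 0 < z.re) :
    SupMultiplier (fun ξ : V n => Complex.exp (-(z * (‖ξ‖ : ℂ))))
      (‖((1 / 2) * (Real.pi / z) ^ (1 / 2 : ℂ) * (Real.pi * z) ^ ((n : ℂ) / 2))⁻¹‖ *
        ∫ y : V n, ‖∫ r in Set.Ioi (0 : ℝ),
          (r : ℂ) ^ n * Complex.exp (-(z + (‖y‖ : ℂ) ^ 2 / z) * (r : ℂ) ^ 2)‖) := by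
  have hz0 : z ≠ 0 := by rintro rfl; simp at hz
  have hpi : (Real.pi : ℂ) ≠ 0 := by exact_mod_cast Real.pi_ne_zero
  set β : ℝ := z.re / Complex.normSq z with hβ
  have hβ0 : 0 < β := div_pos hz (Complex.normSq_pos.2 hz0)
  set k : V n → ℝ → ℂ := fun y r =>
    (r : ℂ) ^ n * Complex.exp (-(z + (‖y‖ : ℂ) ^ 2 / z) * (r : ℂ) ^ 2) with hk
  have hknorm : ∀ y r, 0 < r →
      ‖k y r‖ = r ^ n * Real.exp (-z.re * r ^ 2) * Real.exp (-(β * r ^ 2) * ‖y‖ ^ 2) := by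
    intro y r hr
    simp only [hk]
    rw [norm_mul, norm_pow, Complex.norm_real, Real.norm_of_nonneg hr.le, Complex.norm_exp,
      mul_assoc, ← Real.exp_add]
    congr 2
    rw [← Complex.ofReal_pow, ← Complex.ofReal_pow, Complex.re_mul_ofReal, Complex.neg_re,
      Complex.add_re, Complex.div_re]
    simp only [Complex.ofReal_re, Complex.ofReal_im, zero_mul, zero_div, add_zero, hβ]
    ring
  have hkm : Measurable (Function.uncurry k) := by
    simp only [hk, Function.uncurry_def]
    fun_prop
  have hint : Integrable (Function.uncurry k)
      ((volume : Measure (V n)).prod (volume.restrict (Set.Ioi (0 : ℝ)))) := by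
    rw [integrable_prod_iff' hkm.aestronglyMeasurable]
    constructor
    · refine (ae_restrict_mem measurableSet_Ioi).mono fun r hr => ?_
      have hr' : 0 < r := hr
      have h := (GaussianFourier.integrable_cexp_neg_mul_sq_norm_add (V := V n)
        (b := ((β * r ^ 2 : ℝ) : ℂ)) (by rw [Complex.ofReal_re]; positivity) 0 0).norm.const_mul
          (r ^ n * Real.exp (-z.re * r ^ 2))
      refine h.mono' (hkm.comp measurable_prodMk_right).aestronglyMeasurable
        (.of_forall fun y => ?_)
      simp only [Function.uncurry]
      rw [hknorm y r hr, Complex.norm_exp, zero_mul, add_zero, ← Complex.ofReal_pow,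
        ← Complex.ofReal_neg, ← Complex.ofReal_mul, Complex.ofReal_re]
    · have h : IntegrableOn (fun r : ℝ => (Real.pi / β) ^ ((n : ℝ) / 2) *
          Real.exp (-z.re * r ^ 2)) (Set.Ioi 0) :=
        ((integrable_exp_neg_mul_sq hz).const_mul _).integrableOn
      refine IntegrableOn.congr_fun h (fun r hr => ?_) measurableSet_Ioi
      have hr' : 0 < r := hr
      simp only [Function.uncurry, hknorm _ r hr]
      have hpow : (Real.pi / (β * r ^ 2)) ^ ((n : ℝ) / 2) =
          (Real.pi / β) ^ ((n : ℝ) / 2) / r ^ n := by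
        rw [← div_div, Real.div_rpow (by positivity) (by positivity), ← Real.rpow_natCast_mul hr'.le,
          show ((2 : ℕ) : ℝ) * ((n : ℝ) / 2) = n by push_cast; ring, Real.rpow_natCast]
      rw [integral_const_mul, GaussianFourier.integral_rexp_neg_mul_sq_norm (by positivity),
        finrank_euclideanSpace_fin, hpow]
      field_simp
  have hK : Integrable fun y => ∫ r in Set.Ioi (0 : ℝ), k y r := hint.integral_prod_left
  have hmul := (SupMultiplier.of_kernel hK).const_mul
    ((1 / 2) * (Real.pi / z) ^ (1 / 2 : ℂ) * (Real.pi * z) ^ ((n : ℂ) / 2))⁻¹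
  convert hmul using 2 with ξ
  have hFT : FT (fun y => ∫ r in Set.Ioi (0 : ℝ), k y r) ξ =
      (Real.pi * z) ^ ((n : ℂ) / 2) * ∫ r in Set.Ioi (0 : ℝ),
        Complex.exp (-z * ((r ^ 2 + (‖ξ‖ / 2) ^ 2 / r ^ 2 : ℝ) : ℂ)) := by
    simp only [FT, ← integral_const_mul]
    rw [integral_integral_swap]
    · refine setIntegral_congr_fun measurableSet_Ioi fun r hr => ?_
      have hr' : (r : ℂ) ≠ 0 := by exact_mod_cast (ne_of_gt hr)
      have h := FT_gaussian hz hr ξ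
      simp only [FT] at h
      have h2 : ∀ y : V n, Complex.exp (-(Complex.I * ((⟪y, ξ⟫ : ℝ) : ℂ))) * k y r =
          (r : ℂ) ^ n * Complex.exp (-z * (r : ℂ) ^ 2) *
          (Complex.exp (-(Complex.I * ((⟪y, ξ⟫ : ℝ) : ℂ))) *
            Complex.exp (-((r : ℂ) ^ 2 / z) * (‖y‖ : ℂ) ^ 2)) := by
        intro y
        have h3 : -(z + (‖y‖ : ℂ) ^ 2 / z) * (r : ℂ) ^ 2 =
          -z * (r : ℂ) ^ 2 + -((r : ℂ) ^ 2 / z) * (‖y‖ : ℂ) ^ 2 := by ring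
        simp only [hk, h3, Complex.exp_add]
        ring
      simp only [h2]
      rw [integral_const_mul, h, Complex.ofReal_add, mul_add, Complex.exp_add,
        Complex.ofReal_pow]
      field_simp
    · refine hint.mono ?_ (.of_forall fun p => ?_)
      · exact (Continuous.measurable (by fun_prop)).aestronglyMeasurable.mul
          hkm.aestronglyMeasurable
      · simp only [Function.uncurry]
        rw [← mul_neg, ← Complex.ofReal_neg, norm_exp_I_mul_ofReal_mul]
  rw [hFT, integral_exp_neg_mul_sq_add_div_sq hz (by positivity)]
  have h1 : ((Real.pi : ℂ) * z) ^ ((n : ℂ) / 2) ≠ 0 :=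
    Complex.cpow_ne_zero_iff.2 (.inl (mul_ne_zero hpi hz0))
  have h2 : ((Real.pi : ℂ) / z) ^ (1 / 2 : ℂ) ≠ 0 :=
    Complex.cpow_ne_zero_iff.2 (.inl (div_ne_zero hpi hz0))
  have h3 : -(2 * ((‖ξ‖ / 2 : ℝ) : ℂ) * z) = -(z * (‖ξ‖ : ℂ)) := by push_cast; ring
  rw [h3]
  field_simp

lemma integrable_sq_add_sq_rpow {δ : ℝ} (hδ : 0 < δ) (t : ℝ) :
    Integrable (fun r : ℝ => (δ ^ 2 + (r - t) ^ 2) ^ (-(3 / 4) : ℝ)) ∧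
    ∫ r : ℝ, (δ ^ 2 + (r - t) ^ 2) ^ (-(3 / 4) : ℝ) =
      δ ^ (-(1 / 2) : ℝ) * ∫ r : ℝ, (1 + r ^ 2) ^ (-(3 / 4) : ℝ) := by
  have hJ : Integrable (fun r : ℝ => (1 + r ^ 2) ^ (-(3 / 4) : ℝ)) := by
    have h := integrable_rpow_neg_one_add_norm_sq (E := ℝ) (μ := volume) (r := 3 / 2)
      (by norm_num)
    refine h.congr (.of_forall fun r => ?_)
    simp only [Real.norm_eq_abs, sq_abs]
    norm_num
  have heq : ∀ r : ℝ, (δ ^ 2 + (r - t) ^ 2) ^ (-(3 / 4) : ℝ) =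
      δ ^ (-(3 / 2) : ℝ) * (1 + ((r - t) / δ) ^ 2) ^ (-(3 / 4) : ℝ) := by
    intro r
    have h1 : δ ^ 2 + (r - t) ^ 2 = δ ^ 2 * (1 + ((r - t) / δ) ^ 2) := by field_simp
    rw [h1, Real.mul_rpow (by positivity) (by positivity), ← Real.rpow_natCast_mul hδ.le]
    norm_num
  simp only [heq]
  constructor
  · exact ((hJ.comp_div hδ.ne').comp_sub_right t).const_mul _
  · rw [integral_const_mul, integral_sub_right_eq_self
      (fun r : ℝ => (1 + (r / δ) ^ 2) ^ (-(3 / 4) : ℝ)) t,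
      Measure.integral_comp_div (fun r : ℝ => (1 + r ^ 2) ^ (-(3 / 4) : ℝ)) δ, smul_eq_mul,
      abs_of_pos hδ, ← mul_assoc]
    congr 1
    nth_rewrite 2 [← Real.rpow_one δ]
    rw [← Real.rpow_add hδ]
    norm_num

lemma pow_mul_rpow_le {n : ℕ} (hn : 2 ≤ n) {r D E Z κ : ℝ} (hr : 0 < r) (hD : 0 < D)
    (hZ : 0 < Z) (hEr : r ≤ E) (hEZ : Z ≤ E) (hκ : 0 ≤ κ) (hrD : r ≤ κ * D) :
    r ^ (n - 1) * (D * E / Z) ^ (-(((n : ℝ) + 1) / 2)) ≤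
      κ ^ ((n : ℝ) / 2 - 1) * Z ^ ((n : ℝ) / 2) * D ^ (-(3 / 2) : ℝ) := by
  have hE : 0 < E := hr.trans_le hEr
  have hn' : (2 : ℝ) ≤ n := by exact_mod_cast hn
  have h1 : E ^ (-(((n : ℝ) + 1) / 2)) ≤ r ^ (-((n : ℝ) / 2)) * Z ^ (-(1 / 2) : ℝ) := by
    rw [show -(((n : ℝ) + 1) / 2) = -((n : ℝ) / 2) + -(1 / 2) by ring, Real.rpow_add hE]
    exact mul_le_mul (Real.rpow_le_rpow_of_nonpos hr hEr (by linarith))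
      (Real.rpow_le_rpow_of_nonpos hZ hEZ (by norm_num)) (by positivity) (by positivity)
  have h2 : r ^ ((n : ℝ) / 2 - 1) ≤ κ ^ ((n : ℝ) / 2 - 1) * D ^ ((n : ℝ) / 2 - 1) := by
    rw [← Real.mul_rpow hκ hD.le]
    exact Real.rpow_le_rpow hr.le hrD (by linarith)
  have h3 : r ^ (n - 1) = r ^ ((n : ℝ) / 2 - 1) * r ^ ((n : ℝ) / 2) := by
    rw [← Real.rpow_add hr, ← Real.rpow_natCast, Nat.cast_sub (by omega)]
    congr 1
    push_cast
    ring
  have h4 : (D * E / Z) ^ (-(((n : ℝ) + 1) / 2)) =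
      D ^ (-(((n : ℝ) + 1) / 2)) * E ^ (-(((n : ℝ) + 1) / 2)) * Z ^ (((n : ℝ) + 1) / 2) := by
    rw [Real.div_rpow (by positivity) hZ.le, Real.mul_rpow hD.le hE.le, Real.rpow_neg hZ.le,
      div_inv_eq_mul]
  calc r ^ (n - 1) * (D * E / Z) ^ (-(((n : ℝ) + 1) / 2))
      ≤ (κ ^ ((n : ℝ) / 2 - 1) * D ^ ((n : ℝ) / 2 - 1)) * r ^ ((n : ℝ) / 2) *
        (D ^ (-(((n : ℝ) + 1) / 2)) * (r ^ (-((n : ℝ) / 2)) * Z ^ (-(1 / 2) : ℝ)) *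
          Z ^ (((n : ℝ) + 1) / 2)) := by
        rw [h3, h4]
        gcongr
    _ = κ ^ ((n : ℝ) / 2 - 1) * (Z ^ (-(1 / 2) : ℝ) * Z ^ (((n : ℝ) + 1) / 2)) *
        (D ^ ((n : ℝ) / 2 - 1) * D ^ (-(((n : ℝ) + 1) / 2))) *
        (r ^ ((n : ℝ) / 2) * r ^ (-((n : ℝ) / 2))) := by ring
    _ = _ := by
        rw [← Real.rpow_add hZ, ← Real.rpow_add hD, ← Real.rpow_add hr, add_neg_cancel,
          Real.rpow_zero, mul_one]
        congr 3 <;> ring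

/-- The half-wave propagator regularised by a Poisson semigroup. -/
lemma exists_supMultiplier_exp_neg_mul_norm {n : ℕ} (hn : 2 ≤ n) :
    ∃ C : ℝ, 0 ≤ C ∧ ∀ δ : ℝ, 0 < δ → ∀ t ∈ Set.Icc (1 : ℝ) 2,
      SupMultiplier (fun ξ : V n => Complex.exp (-(((δ : ℂ) - t * Complex.I) * (‖ξ‖ : ℂ))))
        (C * (1 + 2 / δ) ^ (((n : ℝ) - 1) / 2)) := by
  obtain ⟨c, hc⟩ := exists_norm_integral_pow_mul_exp_neg_mul_sq n
  have : Nonempty (Fin n) := ⟨⟨0, by omega⟩⟩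
  have hn' : (2 : ℝ) ≤ n := by exact_mod_cast hn
  have hc0 : 0 ≤ c := by
    have h := hc 1 (by simp)
    rw [norm_one, Real.one_rpow, mul_one] at h
    exact h ▸ norm_nonneg _
  set J : ℝ := ∫ r : ℝ, (1 + r ^ 2) ^ (-(3 / 4) : ℝ) with hJ
  have hJ0 : 0 ≤ J := integral_nonneg fun r => by positivity
  set v : ℝ := (volume : Measure (V n)).real (Metric.ball 0 1) with hv
  have hv0 : 0 ≤ v := measureReal_nonneg
  set A : ℝ := ((1 / 2) * Real.pi ^ (1 / 2 : ℝ) * Real.pi ^ ((n : ℝ) / 2))⁻¹ with hA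
  have hA0 : 0 ≤ A := by positivity
  refine ⟨A * (c * (n * (v * J))), by positivity, fun δ hδ t ht => ?_⟩
  set z : ℂ := (δ : ℂ) - t * Complex.I with hz
  have hzre : z.re = δ := by simp [hz]
  have hzim : z.im = -t := by simp [hz]
  have hz' : 0 < z.re := by rw [hzre]; exact hδ
  have hz0 : z ≠ 0 := by rintro h; simp [h] at hz'
  have hZ0 : 0 < ‖z‖ := norm_pos_iff.2 hz0
  have ht1 := ht.1
  have ht2 := ht.2
  set κ : ℝ := 1 + 2 / δ with hκ
  have hκ0 : 0 < κ := by positivity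
  have hκδ : κ * δ = δ + 2 := by rw [hκ]; field_simp
  have hκ1 : 1 ≤ κ := by rw [hκ]; linarith [div_pos two_pos hδ]
  have hZκ : ‖z‖ ≤ κ * δ := by
    rw [hκδ]
    refine (Complex.norm_le_abs_re_add_abs_im z).trans ?_
    rw [hzre, hzim, abs_of_pos hδ, abs_neg, abs_of_pos (by linarith)]
    linarith
  have hpoint : ∀ r : ℝ, 0 < r →
      r ^ (n - 1) * ‖z + (r : ℂ) ^ 2 / z‖ ^ (-(((n : ℝ) + 1) / 2)) ≤
      κ ^ ((n : ℝ) / 2 - 1) * ‖z‖ ^ ((n : ℝ) / 2) *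
        (δ ^ 2 + (r - t) ^ 2) ^ (-(3 / 4) : ℝ) := by
    intro r hr
    set D := ‖z + r * Complex.I‖ with hD
    set E := ‖z - r * Complex.I‖ with hE
    have hDsq : D ^ 2 = δ ^ 2 + (r - t) ^ 2 := by
      rw [hD, ← Complex.normSq_eq_norm_sq, Complex.normSq_apply]
      simp [hzre, hzim]
      ring
    have hEsq : E ^ 2 = δ ^ 2 + (r + t) ^ 2 := by
      rw [hE, ← Complex.normSq_eq_norm_sq, Complex.normSq_apply]
      simp [hzre, hzim]
      ring
    have hZsq : ‖z‖ ^ 2 = δ ^ 2 + t ^ 2 := by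
      rw [← Complex.normSq_eq_norm_sq, Complex.normSq_apply, hzre, hzim]
      ring
    have hD0 : 0 ≤ D := norm_nonneg _
    have hE0 : 0 ≤ E := norm_nonneg _
    have hDδ : δ ≤ D := by
      refine (le_abs_self _).trans (abs_le_of_sq_le_sq ?_ hD0)
      rw [hDsq]
      nlinarith [sq_nonneg (r - t)]
    have hDr : r - t ≤ D := by
      refine (le_abs_self _).trans (abs_le_of_sq_le_sq ?_ hD0)
      rw [hDsq]
      nlinarith [sq_nonneg δ]
    have hw : ‖z + (r : ℂ) ^ 2 / z‖ = D * E / ‖z‖ := by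
      rw [hD, hE, ← norm_mul, ← norm_div]
      congr 1
      field_simp
      linear_combination (r : ℂ) ^ 2 * Complex.I_sq
    have hDpow : (δ ^ 2 + (r - t) ^ 2) ^ (-(3 / 4) : ℝ) = D ^ (-(3 / 2) : ℝ) := by
      rw [← hDsq, ← Real.rpow_natCast_mul hD0]
      norm_num
    rw [hw, hDpow]
    refine pow_mul_rpow_le hn hr (hδ.trans_le hDδ) hZ0 ?_ ?_ hκ0.le ?_
    · refine (le_abs_self _).trans (abs_le_of_sq_le_sq ?_ hE0)
      rw [hEsq]
      nlinarith [sq_nonneg δ]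
    · refine (le_abs_self _).trans (abs_le_of_sq_le_sq ?_ hE0)
      rw [hEsq, hZsq]
      nlinarith [sq_nonneg δ]
    · have : κ * D = D + 2 * (D / δ) := by rw [hκ]; ring
      have : 1 ≤ D / δ := (one_le_div hδ).2 hDδ
      linarith
  have hre : ∀ y : V n, 0 < (z + (‖y‖ : ℂ) ^ 2 / z).re := by
    intro y
    rw [← Complex.ofReal_pow, Complex.add_re, Complex.div_re]
    simp only [Complex.ofReal_re, Complex.ofReal_im, zero_mul, zero_div, add_zero]
    have := Complex.normSq_pos.2 hz0
    positivity
  refine (supMultiplier_exp_neg_mul_norm_aux hz').mono ?_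
  obtain ⟨hint, hval⟩ := integrable_sq_add_sq_rpow hδ t
  have hI : ∫ y : V n, ‖∫ r in Set.Ioi (0 : ℝ),
      (r : ℂ) ^ n * Complex.exp (-(z + (‖y‖ : ℂ) ^ 2 / z) * (r : ℂ) ^ 2)‖ ≤
      c * (n * (v * (κ ^ ((n : ℝ) / 2 - 1) * ‖z‖ ^ ((n : ℝ) / 2) *
        (δ ^ (-(1 / 2) : ℝ) * J)))) := by
    simp only [hc _ (hre _)]
    rw [integral_const_mul, integral_fun_norm_addHaar (volume : Measure (V n))
      (fun r : ℝ => ‖z + (r : ℂ) ^ 2 / z‖ ^ (-(((n : ℝ) + 1) / 2))),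
      finrank_euclideanSpace_fin, nsmul_eq_mul, smul_eq_mul]
    simp only [smul_eq_mul]
    gcongr
    rw [← hval, ← integral_const_mul]
    refine (integral_mono_of_nonneg ?_ (hint.const_mul _).integrableOn ?_).trans
      (setIntegral_le_integral (hint.const_mul _) (.of_forall fun r => by positivity))
    · exact (ae_restrict_mem measurableSet_Ioi).mono fun r hr => by
        have : 0 < r := hr
        simp only [Pi.zero_apply]
        positivity
    · exact (ae_restrict_mem measurableSet_Ioi).mono fun r hr => hpoint r hr
  have hAz : ‖((1 / 2) * (Real.pi / z) ^ (1 / 2 : ℂ) * (Real.pi * z) ^ ((n : ℂ) / 2))⁻¹‖ =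
      A * (‖z‖ ^ (1 / 2 : ℝ) * ‖z‖ ^ (-((n : ℝ) / 2))) := by
    rw [show (1 / 2 : ℂ) = ((1 / 2 : ℝ) : ℂ) by push_cast; rfl,
      show ((n : ℂ) / 2) = (((n : ℝ) / 2 : ℝ) : ℂ) by push_cast; rfl, norm_inv, norm_mul, norm_mul,
      Complex.norm_cpow_real, Complex.norm_cpow_real, norm_div, norm_mul, Complex.norm_real,
      Complex.norm_real, Real.norm_of_nonneg Real.pi_pos.le,
      Real.norm_of_nonneg (by norm_num : (0 : ℝ) ≤ 1 / 2), Real.div_rpow Real.pi_pos.le hZ0.le,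
      Real.mul_rpow Real.pi_pos.le hZ0.le, Real.rpow_neg hZ0.le, hA]
    field_simp
  rw [hAz]
  have hδ2 : ‖z‖ ^ (1 / 2 : ℝ) ≤ κ ^ (1 / 2 : ℝ) * δ ^ (1 / 2 : ℝ) := by
    rw [← Real.mul_rpow hκ0.le hδ.le]
    exact Real.rpow_le_rpow hZ0.le hZκ (by norm_num)
  calc A * (‖z‖ ^ (1 / 2 : ℝ) * ‖z‖ ^ (-((n : ℝ) / 2))) * _
      ≤ A * ((κ ^ (1 / 2 : ℝ) * δ ^ (1 / 2 : ℝ)) * ‖z‖ ^ (-((n : ℝ) / 2))) *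
        (c * (n * (v * (κ ^ ((n : ℝ) / 2 - 1) * ‖z‖ ^ ((n : ℝ) / 2) *
        (δ ^ (-(1 / 2) : ℝ) * J))))) := by gcongr
    _ = A * (c * (n * (v * J))) * (κ ^ (1 / 2 : ℝ) * κ ^ ((n : ℝ) / 2 - 1)) *
        (‖z‖ ^ (-((n : ℝ) / 2)) * ‖z‖ ^ ((n : ℝ) / 2)) *
        (δ ^ (1 / 2 : ℝ) * δ ^ (-(1 / 2) : ℝ)) := by ring
    _ = _ := by
        rw [← Real.rpow_add hκ0, ← Real.rpow_add hZ0, ← Real.rpow_add hδ, neg_add_cancel,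
          add_neg_cancel, Real.rpow_zero, Real.rpow_zero, mul_one, mul_one]
        congr 2
        ring

/-- The regularised half-wave propagator `(κ + |ξ|)^{-M} e^{it|ξ|}`. -/
lemma exists_supMultiplier_inv_add_norm_pow {n : ℕ} (hn : 2 ≤ n) {M : ℕ}
    (hM : ((n : ℝ) - 1) / 2 < M) :
    ∃ C : ℝ, ∀ κ : ℝ, 1 ≤ κ → ∀ t ∈ Set.Icc (1 : ℝ) 2,
      SupMultiplier (fun ξ : V n => ((((κ + ‖ξ‖)⁻¹ ^ M : ℝ)) : ℂ) *
        Complex.exp (t * Complex.I * (‖ξ‖ : ℂ)))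
        (C * κ ^ (((n : ℝ) - 1) / 2 - M)) := by
  obtain ⟨C, hC0, hC⟩ := exists_supMultiplier_exp_neg_mul_norm hn
  have hn' : (2 : ℝ) ≤ n := by exact_mod_cast hn
  set a : ℝ := ((n : ℝ) - 1) / 2 with ha
  have ha0 : 0 ≤ a := by rw [ha]; linarith
  have hM0 : (0 : ℝ) < M := ha0.trans_lt hM
  set g : ℝ → ℝ := fun u => 2 ^ a * (Real.exp (-u) * u ^ ((M : ℝ) - 1)) +
    4 ^ a * (Real.exp (-u) * u ^ ((M - a : ℝ) - 1)) with hg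
  have hgi : IntegrableOn g (Set.Ioi 0) :=
    ((Real.GammaIntegral_convergent hM0).const_mul _).add
      ((Real.GammaIntegral_convergent (sub_pos.2 hM)).const_mul _)
  have hgle : ∀ u : ℝ, 0 < u →
      Real.exp (-u) * u ^ ((M : ℝ) - 1) * (1 + 2 / u) ^ a ≤ g u := by
    intro u hu
    have h1 : (1 + 2 / u) ^ a ≤ 2 ^ a + 4 ^ a * u ^ (-a) := by
      have h2 : (4 : ℝ) ^ a * u ^ (-a) = (4 / u) ^ a := by
        rw [Real.div_rpow (by norm_num) hu.le, Real.rpow_neg hu.le, div_eq_mul_inv]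
      rw [h2]
      have h42 : 4 / u = 2 * (2 / u) := by ring
      rcases le_total (2 / u) 1 with h | h
      · exact (Real.rpow_le_rpow (by positivity) (by linarith) ha0).trans
          (le_add_of_nonneg_right (by positivity))
      · exact (Real.rpow_le_rpow (by positivity) (by rw [h42]; linarith) ha0).trans
          (le_add_of_nonneg_left (by positivity))
    refine (mul_le_mul_of_nonneg_left h1 (by positivity)).trans_eq ?_
    simp only [hg]
    rw [show (M : ℝ) - a - 1 = ((M : ℝ) - 1) + -a by ring, Real.rpow_add hu]
    ring
  refine ⟨(Real.Gamma M)⁻¹ * (C * ∫ u in Set.Ioi 0, g u), fun κ hκ t ht => ?_⟩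
  have hκ0 : 0 < κ := by linarith
  set m : ℝ → V n → ℂ := fun δ ξ => ((Real.exp (-(κ * δ)) * δ ^ ((M : ℝ) - 1) : ℝ) : ℂ) *
    Complex.exp (-(((δ : ℂ) - t * Complex.I) * (‖ξ‖ : ℂ))) with hm
  have hmeas : Measurable (Function.uncurry m) := by
    simp only [hm, Function.uncurry_def]
    fun_prop
  have hbound : ∀ᵐ δ ∂(volume.restrict (Set.Ioi (0 : ℝ))),
      SupMultiplier (m δ) (C * κ ^ (a + 1 - M) * g (κ * δ)) := by
    filter_upwards [ae_restrict_mem measurableSet_Ioi] with δ hδ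
    have hδ : 0 < δ := hδ
    refine ((hC δ hδ t ht).const_mul _).mono ?_
    rw [Complex.norm_real, Real.norm_of_nonneg (by positivity)]
    have h1 : (1 + 2 / δ) ^ a ≤ κ ^ a * (1 + 2 / (κ * δ)) ^ a := by
      rw [← Real.mul_rpow hκ0.le (by positivity)]
      refine Real.rpow_le_rpow (by positivity) ?_ ha0
      have : κ * (1 + 2 / (κ * δ)) = κ + 2 / δ := by field_simp
      rw [this]
      linarith
    have h2 : κ ^ (a + 1 - M) * (κ * δ) ^ ((M : ℝ) - 1) = κ ^ a * δ ^ ((M : ℝ) - 1) := by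
      rw [Real.mul_rpow hκ0.le hδ.le, ← mul_assoc, ← Real.rpow_add hκ0]
      congr 2
      ring
    calc Real.exp (-(κ * δ)) * δ ^ ((M : ℝ) - 1) * (C * (1 + 2 / δ) ^ a)
        ≤ Real.exp (-(κ * δ)) * δ ^ ((M : ℝ) - 1) * (C * (κ ^ a * (1 + 2 / (κ * δ)) ^ a)) := by
          gcongr
      _ = C * (κ ^ a * δ ^ ((M : ℝ) - 1)) * (Real.exp (-(κ * δ)) * (1 + 2 / (κ * δ)) ^ a) := by
          ring
      _ = C * κ ^ (a + 1 - M) * (Real.exp (-(κ * δ)) * (κ * δ) ^ ((M : ℝ) - 1) *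
          (1 + 2 / (κ * δ)) ^ a) := by rw [← h2]; ring
      _ ≤ _ := by
          gcongr
          exact hgle _ (by positivity)
  have hci : Integrable (fun δ => C * κ ^ (a + 1 - M) * g (κ * δ))
      (volume.restrict (Set.Ioi (0 : ℝ))) := by
    refine Integrable.const_mul ?_ _
    have := (integrableOn_Ioi_comp_mul_left_iff g 0 hκ0).2 (by rwa [mul_zero])
    exact this
  have key := (SupMultiplier.integral hmeas hci hbound).const_mul (((Real.Gamma M)⁻¹ : ℝ) : ℂ)
  have hΓ := Real.Gamma_pos_of_pos hM0
  convert key using 1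
  · ext ξ
    have hpos : 0 < κ + ‖ξ‖ := by positivity
    have h := Real.integral_rpow_mul_exp_neg_mul_Ioi hM0 hpos
    have h1 : ∀ δ : ℝ, m δ ξ = ((δ ^ ((M : ℝ) - 1) * Real.exp (-((κ + ‖ξ‖) * δ)) : ℝ) : ℂ) *
        Complex.exp (t * Complex.I * (‖ξ‖ : ℂ)) := by
      intro δ
      simp only [hm]
      push_cast
      rw [mul_right_comm, ← Complex.exp_add, mul_comm ((δ ^ ((M : ℝ) - 1) : ℝ) : ℂ),
        mul_right_comm, ← Complex.exp_add]
      congr 2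
      ring
    simp only [h1]
    rw [integral_mul_const, integral_complex_ofReal, h, one_div, Real.rpow_natCast, ← mul_assoc,
      ← Complex.ofReal_mul]
    congr 2
    field_simp
  · rw [Complex.norm_real, Real.norm_of_nonneg (by positivity), integral_const_mul,
      integral_comp_mul_left_Ioi _ _ hκ0, mul_zero, smul_eq_mul,
      show a + 1 - M = (a - M) + 1 by ring, Real.rpow_add hκ0, Real.rpow_one]
    field_simp

lemma supMultiplier_exp_neg_mul_norm_sq {n : ℕ} {v : ℝ} (hv : 0 < v) :
    SupMultiplier (fun ξ : V n => ((Real.exp (-(v * ‖ξ‖ ^ 2)) : ℝ) : ℂ)) 1 := by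
  set z : ℂ := ((4 * v : ℝ) : ℂ) with hz
  have hzre : 0 < z.re := by rw [hz, Complex.ofReal_re]; linarith
  have hz0 : z ≠ 0 := by rintro h; simp [h] at hzre
  set K : V n → ℂ := fun y => Complex.exp (-(((1 : ℝ) : ℂ) ^ 2 / z) * (‖y‖ : ℂ) ^ 2) with hK
  have hFT : ∀ ξ, FT K ξ = (Real.pi * z) ^ ((n : ℂ) / 2) *
      ((Real.exp (-(v * ‖ξ‖ ^ 2)) : ℝ) : ℂ) := by
    intro ξ
    rw [hK, FT_gaussian hzre one_pos, hz]
    push_cast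
    rw [one_pow, inv_one, mul_one]
    congr 2
    ring
  set Z : ℂ := (Real.pi * z) ^ ((n : ℂ) / 2) with hZ
  have hZ0 : Z ≠ 0 := by
    rw [hZ, Complex.cpow_def_of_ne_zero (mul_ne_zero (by exact_mod_cast Real.pi_ne_zero) hz0)]
    exact Complex.exp_ne_zero _
  have hnorm : ∀ y, K y = ((‖K y‖ : ℝ) : ℂ) := by
    intro y
    have : K y = ((Real.exp (-((1 : ℝ) ^ 2 / (4 * v)) * ‖y‖ ^ 2) : ℝ) : ℂ) := by
      simp only [hK, hz]
      push_cast
      rfl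
    rw [this, Complex.norm_real, Real.norm_of_nonneg (Real.exp_pos _).le]
  have hI : Z = ((∫ y, ‖K y‖ : ℝ) : ℂ) := by
    have h := hFT 0
    rw [norm_zero] at h
    rw [← integral_complex_ofReal]
    simp only [← hnorm]
    simpa [FT] using h.symm
  have hI0 : ∫ y, ‖K y‖ ≠ 0 := by
    intro h
    exact hZ0 (by rw [hI, h, Complex.ofReal_zero])
  have hKi : Integrable K := by
    have h : Integrable fun y => ‖K y‖ := by
      by_contra h
      exact hI0 (integral_undef h)
    exact (integrable_norm_iff (Continuous.aestronglyMeasurable (by fun_prop))).1 h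
  convert (SupMultiplier.of_kernel hKi).const_mul Z⁻¹ using 1
  · ext ξ
    rw [hFT, inv_mul_cancel_left₀ hZ0]
  · rw [norm_inv, hI, Complex.norm_real, Real.norm_of_nonneg (by positivity),
      inv_mul_cancel₀ hI0]

lemma integral_exp_neg_mul_Ioi_zero {b : ℝ} (hb : 0 < b) :
    ∫ v in Set.Ioi (0 : ℝ), Real.exp (-(b * v)) = b⁻¹ := by
  simpa using Real.integral_rpow_mul_exp_neg_mul_Ioi one_pos hb

lemma supMultiplier_inv_sq_add_norm_sq {n : ℕ} {κ : ℝ} (hκ : 0 < κ) :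
    SupMultiplier (fun ξ : V n => (((κ ^ 2 + ‖ξ‖ ^ 2)⁻¹ : ℝ) : ℂ)) (κ ^ 2)⁻¹ := by
  set m : ℝ → V n → ℂ := fun v ξ => ((Real.exp (-(κ ^ 2 * v)) : ℝ) : ℂ) *
    ((Real.exp (-(v * ‖ξ‖ ^ 2)) : ℝ) : ℂ) with hm
  have hmeas : Measurable (Function.uncurry m) := by
    simp only [hm, Function.uncurry_def]
    fun_prop
  have hκ2 : 0 < κ ^ 2 := by positivity
  have hci : IntegrableOn (fun v => Real.exp (-(κ ^ 2 * v))) (Set.Ioi 0) := by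
    have := integrableOn_exp_mul_Ioi (neg_lt_zero.2 hκ2) 0
    simpa only [neg_mul] using this
  have hbound : ∀ᵐ v ∂(volume.restrict (Set.Ioi (0 : ℝ))),
      SupMultiplier (m v) (Real.exp (-(κ ^ 2 * v))) := by
    filter_upwards [ae_restrict_mem measurableSet_Ioi] with v hv
    convert (supMultiplier_exp_neg_mul_norm_sq (n := n) hv).const_mul
      ((Real.exp (-(κ ^ 2 * v)) : ℝ) : ℂ) using 1
    rw [Complex.norm_real, Real.norm_of_nonneg (Real.exp_pos _).le, mul_one]
  convert SupMultiplier.integral hmeas hci hbound using 1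
  · ext ξ
    have h : ∀ v : ℝ, m v ξ = ((Real.exp (-((κ ^ 2 + ‖ξ‖ ^ 2) * v)) : ℝ) : ℂ) := by
      intro v
      simp only [hm]
      rw [← Complex.ofReal_mul, ← Real.exp_add]
      congr 2
      ring
    simp only [h]
    rw [integral_complex_ofReal, integral_exp_neg_mul_Ioi_zero (by positivity)]
  · rw [integral_exp_neg_mul_Ioi_zero hκ2]

lemma supMultiplier_norm_sq_div {n : ℕ} {κ : ℝ} (hκ : 0 < κ) :
    SupMultiplier (fun ξ : V n => ((‖ξ‖ ^ 2 / (κ ^ 2 + ‖ξ‖ ^ 2) : ℝ) : ℂ)) 2 := by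
  convert (SupMultiplier.const 1).add
    ((supMultiplier_inv_sq_add_norm_sq (n := n) hκ).const_mul (-(κ ^ 2 : ℝ) : ℂ)) using 1
  · ext ξ
    rw [← Complex.ofReal_neg, ← Complex.ofReal_mul, ← Complex.ofReal_one, ← Complex.ofReal_add]
    congr 1
    field_simp
    ring
  · rw [norm_one, norm_neg, Complex.norm_real, Real.norm_of_nonneg (by positivity)]
    field_simp
    norm_num

lemma integrable_inv_sq_add_sq {κ : ℝ} (hκ : 0 < κ) :
    Integrable (fun y : ℝ => (κ ^ 2 + y ^ 2)⁻¹) ∧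
      ∫ y : ℝ, (κ ^ 2 + y ^ 2)⁻¹ = κ⁻¹ * Real.pi := by
  have h : ∀ y : ℝ, (κ ^ 2 + y ^ 2)⁻¹ = (κ ^ 2)⁻¹ * (1 + (y / κ) ^ 2)⁻¹ := by
    intro y
    field_simp
  simp only [h]
  refine ⟨(integrable_inv_one_add_sq.comp_div hκ.ne').const_mul _, ?_⟩
  rw [integral_const_mul, Measure.integral_comp_div (fun y : ℝ => (1 + y ^ 2)⁻¹) κ,
    integral_univ_inv_one_add_sq, smul_eq_mul, abs_of_pos hκ]
  field_simp

lemma supMultiplier_norm_div_sq_add_norm_sq {n : ℕ} {κ : ℝ} (hκ : 0 < κ) :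
    SupMultiplier (fun ξ : V n => ((‖ξ‖ / (κ ^ 2 + ‖ξ‖ ^ 2) : ℝ) : ℂ)) (4 / κ) := by
  set m : ℝ → V n → ℂ := fun y ξ => ((‖ξ‖ ^ 2 / (y ^ 2 + ‖ξ‖ ^ 2) : ℝ) : ℂ) *
    (((κ ^ 2 + ‖ξ‖ ^ 2)⁻¹ : ℝ) : ℂ) with hm
  have hmeas : Measurable (Function.uncurry m) := by
    simp only [hm, Function.uncurry_def]
    fun_prop
  obtain ⟨hint, hval⟩ := integrable_inv_sq_add_sq hκ
  have hbound : ∀ᵐ y : ℝ, SupMultiplier (m y) (4 * (κ ^ 2 + y ^ 2)⁻¹) := by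
    filter_upwards [Measure.ae_ne volume (0 : ℝ)] with y hy
    have hy0 : 0 < |y| := abs_pos.2 hy
    have hy2 : 0 < y ^ 2 := by positivity
    have hκ2 : 0 < κ ^ 2 := by positivity
    rcases le_total (y ^ 2) (κ ^ 2) with h | h
    · have h1 := (supMultiplier_norm_sq_div (n := n) hy0).mul
        (supMultiplier_inv_sq_add_norm_sq (n := n) hκ)
      simp only [sq_abs] at h1
      refine h1.mono ?_
      rw [← div_eq_mul_inv, ← div_eq_mul_inv, div_le_div_iff₀ hκ2 (by positivity)]
      linarith
    · have h1 := (supMultiplier_norm_sq_div (n := n) hκ).mul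
        (supMultiplier_inv_sq_add_norm_sq (n := n) hy0)
      simp only [sq_abs] at h1
      have h2 := h1.mono (C₂ := 4 * (κ ^ 2 + y ^ 2)⁻¹) (by
        rw [← div_eq_mul_inv, ← div_eq_mul_inv, div_le_div_iff₀ hy2 (by positivity)]
        linarith)
      convert h2 using 1
      ext ξ
      simp only [hm]
      push_cast
      ring
  convert (SupMultiplier.integral hmeas (hint.const_mul 4) hbound).const_mul
    ((Real.pi⁻¹ : ℝ) : ℂ) using 1
  · ext ξ
    simp only [hm]
    rw [integral_mul_const, integral_complex_ofReal]
    simp only [div_eq_mul_inv, integral_const_mul]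
    rw [← Complex.ofReal_mul, ← Complex.ofReal_mul]
    congr 1
    rcases eq_or_lt_of_le (norm_nonneg ξ) with h | h
    · simp [← h]
    · have h1 := (integrable_inv_sq_add_sq h).2
      simp only [add_comm (‖ξ‖ ^ 2)] at h1
      rw [h1]
      have := Real.pi_pos
      field_simp
  · have := Real.pi_pos
    rw [integral_const_mul, hval, Complex.norm_real, Real.norm_of_nonneg (by positivity)]
    field_simp

lemma exists_supMultiplier_inv_sq_add_norm_sq_pow {n : ℕ} (hn : 2 ≤ n) {N : ℕ}
    (hN : ((n : ℝ) - 1) / 2 < 2 * N) :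
    ∃ C : ℝ, ∀ κ : ℝ, 1 ≤ κ → ∀ t ∈ Set.Icc (1 : ℝ) 2,
      SupMultiplier (fun ξ : V n => ((((κ ^ 2 + ‖ξ‖ ^ 2)⁻¹ ^ N : ℝ)) : ℂ) *
        Complex.exp (t * Complex.I * (‖ξ‖ : ℂ)))
        (C * κ ^ (((n : ℝ) - 1) / 2 - 2 * N)) := by
  obtain ⟨C, hC⟩ := exists_supMultiplier_inv_add_norm_pow hn (M := 2 * N)
    (by push_cast; exact hN)
  refine ⟨C * 9 ^ N, fun κ hκ t ht => ?_⟩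
  have hκ0 : 0 < κ := by linarith
  have h1 := ((SupMultiplier.const 1).add
    ((supMultiplier_norm_div_sq_add_norm_sq (n := n) hκ0).const_mul ((2 * κ : ℝ) : ℂ))).pow N
  convert (hC κ hκ t ht).mul h1 using 1
  · ext ξ
    rw [mul_right_comm (((κ + ‖ξ‖)⁻¹ ^ (2 * N) : ℝ) : ℂ)]
    congr 1
    rw [← Complex.ofReal_one, ← Complex.ofReal_mul, ← Complex.ofReal_add, ← Complex.ofReal_pow,
      ← Complex.ofReal_mul, pow_mul, ← mul_pow]
    congr 2
    have : 0 < κ + ‖ξ‖ := by positivity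
    field_simp
    ring
  · rw [norm_one, Complex.norm_real, Real.norm_of_nonneg (by positivity),
      show 1 + 2 * κ * (4 / κ) = 9 by field_simp; norm_num]
    push_cast
    ring

lemma integrableOn_rpow_mul_one_add_rpow {p q : ℝ} (hp : 0 < p) (hpq : p < q) :
    IntegrableOn (fun x : ℝ => x ^ (p - 1) * (1 + x) ^ (-q)) (Set.Ioi 0) := by
  have hmeas : Measurable fun x : ℝ => x ^ (p - 1) * (1 + x) ^ (-q) := by fun_prop
  rw [← Set.Ioc_union_Ioi_eq_Ioi (zero_le_one' ℝ), integrableOn_union]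
  constructor
  · have h : IntegrableOn (fun x : ℝ => x ^ (p - 1)) (Set.Ioc 0 1) :=
      (intervalIntegrable_iff_integrableOn_Ioc_of_le zero_le_one).1
        (intervalIntegral.intervalIntegrable_rpow' (by linarith))
    refine h.mono' hmeas.aestronglyMeasurable ?_
    filter_upwards [ae_restrict_mem measurableSet_Ioc] with x hx
    have hx0 : 0 < x := hx.1
    rw [Real.norm_of_nonneg (by positivity)]
    refine mul_le_of_le_one_right (by positivity) ?_
    exact Real.rpow_le_one_of_one_le_of_nonpos (by linarith) (by linarith)
  · have h : IntegrableOn (fun x : ℝ => x ^ (p - 1 - q)) (Set.Ioi 1) :=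
      integrableOn_Ioi_rpow_of_lt (by linarith) zero_lt_one
    refine h.mono' hmeas.aestronglyMeasurable ?_
    filter_upwards [ae_restrict_mem measurableSet_Ioi] with x hx
    have hx0 : 0 < x := zero_lt_one.trans (show 1 < x from hx)
    rw [Real.norm_of_nonneg (by positivity), show p - 1 - q = (p - 1) + -q by ring,
      Real.rpow_add hx0]
    refine mul_le_mul_of_nonneg_left ?_ (Real.rpow_nonneg hx0.le _)
    exact Real.rpow_le_rpow_of_nonpos hx0 (by linarith) (by linarith)

lemma integral_rpow_mul_one_add_rpow_pos {p q : ℝ} (hp : 0 < p) (hpq : p < q) :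
    0 < ∫ x in Set.Ioi (0 : ℝ), x ^ (p - 1) * (1 + x) ^ (-q) := by
  have hpos : ∀ x ∈ Set.Ioi (0 : ℝ), 0 < x ^ (p - 1) * (1 + x) ^ (-q) := by
    intro x hx
    have hx : 0 < x := hx
    positivity
  rw [setIntegral_pos_iff_support_of_nonneg_ae
    ((ae_restrict_mem measurableSet_Ioi).mono fun x hx => (hpos x hx).le)
    (integrableOn_rpow_mul_one_add_rpow hp hpq)]
  have hsub : Set.Ioi 0 ⊆ Function.support fun x : ℝ => x ^ (p - 1) * (1 + x) ^ (-q) :=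
    fun x hx => (hpos x hx).ne'
  rw [Set.inter_eq_self_of_subset_right hsub]
  simp

lemma integral_rpow_mul_add_rpow {p q w : ℝ} (hw : 0 < w) :
    ∫ x in Set.Ioi (0 : ℝ), x ^ (p - 1) * (x + w) ^ (-q) =
      w ^ (p - q) * ∫ x in Set.Ioi (0 : ℝ), x ^ (p - 1) * (1 + x) ^ (-q) := by
  have h := integral_comp_mul_left_Ioi' (fun x : ℝ => x ^ (p - 1) * (x + w) ^ (-q)) 0 hw
  rw [mul_zero] at h
  rw [← h, smul_eq_mul, ← integral_const_mul, ← integral_const_mul]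
  refine setIntegral_congr_fun measurableSet_Ioi fun x hx => ?_
  have hx : 0 < x := hx
  rw [Real.mul_rpow hw.le hx.le, show w * x + w = w * (1 + x) by ring,
    Real.mul_rpow hw.le (by positivity), show p - q = 1 + (p - 1) + -q by ring,
    Real.rpow_add hw, Real.rpow_add hw, Real.rpow_one]
  ring

/-- The multiplier `⟨ξ⟩^{-2σ} e^{it|ξ|}` is bounded on `L^∞` for `2σ > (n-1)/2`, uniformly in
`t ∈ [1,2]`. -/
lemma exists_supMultiplier_rpow_mul_exp {n : ℕ} (hn : 2 ≤ n) {σ : ℝ}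
    (hσ : ((n : ℝ) - 1) / 2 < 2 * σ) :
    ∃ C : ℝ, ∀ t ∈ Set.Icc (1 : ℝ) 2,
      SupMultiplier (fun ξ : V n => (((1 + ‖ξ‖ ^ 2) ^ (-σ) : ℝ) : ℂ) *
        Complex.exp (t * Complex.I * (‖ξ‖ : ℂ))) C := by
  have hn' : (2 : ℝ) ≤ n := by exact_mod_cast hn
  obtain ⟨N, hN⟩ := exists_nat_gt σ
  have hσ0 : 0 < σ := by linarith
  obtain ⟨C, hC⟩ := exists_supMultiplier_inv_sq_add_norm_sq_pow hn (N := N) (by linarith)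
  set a : ℝ := ((n : ℝ) - 1) / 2 with ha
  have hp : 0 < N - σ := by linarith
  set c : ℝ := ∫ x in Set.Ioi (0 : ℝ), x ^ ((N - σ) - 1) * (1 + x) ^ (-(N : ℝ)) with hc
  have hc0 : 0 < c := integral_rpow_mul_one_add_rpow_pos hp (by linarith)
  refine ⟨‖((c⁻¹ : ℝ) : ℂ)‖ * ∫ l in Set.Ioi (0 : ℝ),
    C * (l ^ ((N - σ) - 1) * (1 + l) ^ (-(N - a / 2))), fun t ht => ?_⟩
  set m : ℝ → V n → ℂ := fun l ξ => ((l ^ ((N - σ) - 1) : ℝ) : ℂ) *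
    ((((1 + l + ‖ξ‖ ^ 2)⁻¹ ^ N : ℝ) : ℂ) * Complex.exp (t * Complex.I * (‖ξ‖ : ℂ))) with hm
  have hmeas : Measurable (Function.uncurry m) := by
    simp only [hm, Function.uncurry_def]
    fun_prop
  have hbound : ∀ᵐ l ∂(volume.restrict (Set.Ioi (0 : ℝ))),
      SupMultiplier (m l) (C * (l ^ ((N - σ) - 1) * (1 + l) ^ (-(N - a / 2)))) := by
    filter_upwards [ae_restrict_mem measurableSet_Ioi] with l hl
    have hl : 0 < l := hl
    have h := (hC (√(1 + l)) (Real.one_le_sqrt.2 (by linarith)) t ht).const_mul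
      ((l ^ ((N - σ) - 1) : ℝ) : ℂ)
    rw [Real.sq_sqrt (by positivity)] at h
    convert h using 1
    rw [Complex.norm_real, Real.norm_of_nonneg (by positivity), Real.sqrt_eq_rpow,
      ← Real.rpow_mul (by positivity), show 1 / 2 * (a - 2 * N) = -(N - a / 2) by ring]
    ring
  have hci := (integrableOn_rpow_mul_one_add_rpow hp
    (by linarith : (N : ℝ) - σ < N - a / 2)).const_mul C
  convert (SupMultiplier.integral hmeas hci hbound).const_mul ((c⁻¹ : ℝ) : ℂ) using 1
  ext ξ
  have h1 : ∀ l ∈ Set.Ioi (0 : ℝ), m l ξ = ((l ^ ((N - σ) - 1) *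
      (l + (1 + ‖ξ‖ ^ 2)) ^ (-(N : ℝ)) : ℝ) : ℂ) *
        Complex.exp (t * Complex.I * (‖ξ‖ : ℂ)) := by
    intro l hl
    have hl : 0 < l := hl
    simp only [hm]
    rw [Real.rpow_neg (by positivity), Real.rpow_natCast, ← inv_pow, ← mul_assoc,
      ← Complex.ofReal_mul]
    congr 4
    ring
  rw [setIntegral_congr_fun measurableSet_Ioi h1, integral_mul_const, integral_complex_ofReal,
    integral_rpow_mul_add_rpow (by positivity), ← hc, ← mul_assoc, ← Complex.ofReal_mul,
    show (N : ℝ) - σ - N = -σ by ring]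
  congr 2
  field_simp

open scoped FourierTransform

lemma FT_eq_fourier {n : ℕ} (G : V n → ℂ) (ξ : V n) :
    FT G ξ = 𝓕 G ((2 * Real.pi)⁻¹ • ξ) := by
  rw [Real.fourier_eq', FT]
  refine integral_congr_ae (.of_forall fun y => ?_)
  simp only [smul_eq_mul]
  rw [inner_smul_right]
  have := Real.pi_ne_zero
  congr 2
  rw [← mul_assoc, show -2 * Real.pi * (2 * Real.pi)⁻¹ = -1 by field_simp]
  push_cast
  ring

lemma synth_eq_FT_neg {n : ℕ} (G : V n → ℂ) (x : V n) : synth G x = FT G (-x) := by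
  simp only [synth, FT, inner_neg_right, real_inner_comm, Complex.ofReal_neg, mul_neg, neg_neg]

/-- The Fourier inversion formula. -/
lemma synth_FT {n : ℕ} {G : V n → ℂ} (hc : Continuous G) (hG : Integrable G)
    (hFG : Integrable (FT G)) (x : V n) : synth (FT G) x = ((2 * Real.pi) ^ n : ℝ) * G x := by
  have hπ : (2 * Real.pi)⁻¹ ≠ 0 := inv_ne_zero (by positivity)
  have hF : Integrable (𝓕 G) := by
    rw [← integrable_comp_smul_iff volume _ hπ]
    exact hFG.congr (.of_forall (FT_eq_fourier G))
  have h := congrFun (hc.fourierInv_fourier_eq hG hF) x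
  rw [Real.fourierInv_eq'] at h
  have h2 := Measure.integral_comp_smul (volume : Measure (V n)) (fun η : V n =>
    Complex.exp ((2 * Real.pi * ⟪η, x⟫ : ℝ) * Complex.I) • 𝓕 G η) (2 * Real.pi)⁻¹
  rw [h, finrank_euclideanSpace_fin, ← inv_pow, inv_inv, abs_of_pos (by positivity),
    Complex.real_smul] at h2
  rw [← h2, synth]
  refine integral_congr_ae (.of_forall fun ξ => ?_)
  simp only [smul_eq_mul]
  rw [FT_eq_fourier, real_inner_smul_left, mul_inv_cancel_left₀ (by positivity),
    real_inner_comm, mul_comm Complex.I]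

lemma FT_synth {n : ℕ} {G : V n → ℂ} (hc : Continuous G) (hG : Integrable G)
    (hFG : Integrable (synth G)) (ξ : V n) :
    FT (synth G) ξ = ((2 * Real.pi) ^ n : ℝ) * G ξ := by
  have hF : Integrable (FT G) := by
    refine hFG.comp_neg.congr (.of_forall fun x => ?_)
    simp only [synth_eq_FT_neg, neg_neg]
  rw [← synth_FT hc hG hF, FT, synth, ← integral_neg_eq_self]
  refine integral_congr_ae (.of_forall fun y => ?_)
  simp only [synth_eq_FT_neg, neg_neg, inner_neg_left, real_inner_comm, Complex.ofReal_neg, mul_neg]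

lemma continuous_FT_schwartz {n : ℕ} (f : SchwartzMap (V n) ℂ) : Continuous (FT ⇑f) := by
  have h : FT ⇑f = fun ξ => (𝓕 f) ((2 * Real.pi)⁻¹ • ξ) := funext (FT_eq_fourier ⇑f)
  rw [h]
  exact (𝓕 f).continuous.comp (by fun_prop)

lemma integrable_FT_schwartz {n : ℕ} (f : SchwartzMap (V n) ℂ) : Integrable (FT ⇑f) := by
  have h : FT ⇑f = fun ξ => (𝓕 f) ((2 * Real.pi)⁻¹ • ξ) := funext (FT_eq_fourier ⇑f)
  rw [h]
  exact (integrable_comp_smul_iff volume _ (inv_ne_zero (by positivity))).2 (𝓕 f).integrable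

lemma halfWave_eq_synth {n : ℕ} (t : ℝ) (f : V n → ℂ) (x : V n) :
    halfWave t f x = ((((2 * Real.pi) ^ n)⁻¹ : ℝ) : ℂ) *
      synth (fun ξ => Complex.exp (t * Complex.I * (‖ξ‖ : ℂ)) * FT f ξ) x := by
  simp only [halfWave, synth]
  congr 1
  refine integral_congr_ae (.of_forall fun ξ => ?_)
  simp only
  rw [← mul_assoc, ← Complex.exp_add]
  push_cast
  congr 2
  ring

/-- If `halfWave t f` is integrable then its Fourier transform is `e^{it|ξ|} f̂`. -/
lemma FT_halfWave {n : ℕ} {t : ℝ} {f : SchwartzMap (V n) ℂ}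
    (h : Integrable (halfWave t ⇑f)) (ξ : V n) :
    FT (halfWave t ⇑f) ξ = Complex.exp (t * Complex.I * (‖ξ‖ : ℂ)) * FT ⇑f ξ := by
  set G : V n → ℂ := fun ξ => Complex.exp (t * Complex.I * (‖ξ‖ : ℂ)) * FT ⇑f ξ with hG
  have hGc : Continuous G := (Continuous.cexp (by fun_prop)).mul (continuous_FT_schwartz f)
  have hGi : Integrable G := by
    refine (integrable_FT_schwartz f).mono hGc.aestronglyMeasurable (.of_forall fun ξ => ?_)
    simp only [hG]
    rw [mul_comm (t : ℂ), mul_assoc, ← Complex.ofReal_mul, norm_exp_I_mul_ofReal_mul]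
  have hc : ((((2 * Real.pi) ^ n)⁻¹ : ℝ) : ℂ) ≠ 0 := by
    exact_mod_cast inv_ne_zero (by positivity)
  have hw : halfWave t ⇑f = fun x => ((((2 * Real.pi) ^ n)⁻¹ : ℝ) : ℂ) * synth G x :=
    funext (halfWave_eq_synth t ⇑f)
  rw [hw] at h ⊢
  have hs : Integrable (synth G) := (integrable_const_mul_iff (Ne.isUnit hc) _).1 h
  have h1 := FT_synth hGc hGi hs ξ
  rw [FT] at h1 ⊢
  simp only [mul_left_comm _ ((((2 * Real.pi) ^ n)⁻¹ : ℝ) : ℂ)]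
  rw [integral_const_mul, h1, ← mul_assoc, ← Complex.ofReal_mul,
    inv_mul_cancel₀ (by positivity), Complex.ofReal_one, one_mul]

lemma Continuous.enorm_le_eLpNorm_top {n : ℕ} {f : V n → ℂ} (hf : Continuous f) (x : V n) :
    ‖f x‖ₑ ≤ eLpNorm f ⊤ volume := by
  rw [eLpNorm_exponent_top]
  have hcl : IsClosed {x | ‖f x‖ₑ ≤ eLpNormEssSup f volume} :=
    isClosed_le hf.enorm continuous_const
  have hd : Dense {x | ‖f x‖ₑ ≤ eLpNormEssSup f volume} :=
    Measure.dense_of_ae (enorm_ae_le_eLpNormEssSup f volume)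
  have h := hd.closure_eq
  rw [hcl.closure_eq] at h
  exact Set.eq_univ_iff_forall.1 h x

lemma norm_besselD_halfWave_le {n : ℕ} {s t C S : ℝ}
    (hC : SupMultiplier (fun ξ : V n => (((1 + ‖ξ‖ ^ 2) ^ (s / 2) : ℝ) : ℂ) *
      Complex.exp (t * Complex.I * (‖ξ‖ : ℂ))) C)
    {f : SchwartzMap (V n) ℂ} (hS : ∀ x, ‖f x‖ ≤ S) (x : V n) :
    ‖besselD s (halfWave t ⇑f) x‖ ≤ C * S := by
  by_cases h : Integrable (halfWave t ⇑f)
  · have hb : besselD s (halfWave t ⇑f) x = ((((2 * Real.pi) ^ n)⁻¹ : ℝ) : ℂ) *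
        synth (fun ξ => ((((1 + ‖ξ‖ ^ 2) ^ (s / 2) : ℝ) : ℂ) *
          Complex.exp (t * Complex.I * (‖ξ‖ : ℂ))) * FT ⇑f ξ) x := by
      simp only [besselD, synth, FT_halfWave h, mul_assoc]
    have hS' : ∀ y, ‖synth (FT ⇑f) y‖ ≤ (2 * Real.pi) ^ n * S := by
      intro y
      rw [synth_FT f.continuous f.integrable (integrable_FT_schwartz f), norm_mul,
        Complex.norm_real, Real.norm_of_nonneg (by positivity)]
      exact mul_le_mul_of_nonneg_left (hS y) (by positivity)
    have hle := hC.norm_synth_le _ (integrable_FT_schwartz f) _ hS' x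
    rw [hb, norm_mul, Complex.norm_real, Real.norm_of_nonneg (by positivity),
      inv_mul_le_iff₀ (by positivity)]
    exact hle.trans_eq (by ring)
  · have hFT : ∀ ξ, FT (halfWave t ⇑f) ξ = 0 := by
      intro ξ
      refine integral_undef fun h' => h ?_
      refine (integrable_exp_mul h' ξ).congr (.of_forall fun y => ?_)
      simp only
      rw [← mul_assoc, ← Complex.exp_add, real_inner_comm, add_neg_cancel, Complex.exp_zero,
        one_mul]
    simp only [besselD, hFT, mul_zero, integral_zero, norm_zero]
    exact mul_nonneg hC.nonneg ((norm_nonneg _).trans (hS 0))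

/-- for `n ≥ 2` and every `ε > 0` there is a constant `C` such that
`‖⟨D⟩^{−(n−1)/2−ε} e^{it√(−Δ)} f‖_{L^∞(ℝⁿ)} ≤ C‖f‖_{L^∞(ℝⁿ)}` for all Schwartz `f`
and all `t ∈ [1,2]`. -/
theorem halfWave_Linfty_bound (n : ℕ) (hn : 2 ≤ n) :
    ∀ ε : ℝ, 0 < ε →
      ∃ C : ℝ, ∀ f : SchwartzMap (V n) ℂ, ∀ t ∈ Set.Icc (1 : ℝ) 2,
        eLpNorm (besselD (-(((n : ℝ) - 1) / 2) - ε) (halfWave t ⇑f)) ⊤ volume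
          ≤ ENNReal.ofReal C * eLpNorm (⇑f) ⊤ volume := by
  intro ε hε
  obtain ⟨C, hC⟩ := exists_supMultiplier_rpow_mul_exp hn (σ := (((n : ℝ) - 1) / 2 + ε) / 2)
    (by linarith)
  refine ⟨C, fun f t ht => ?_⟩
  have hm := hC t ht
  rw [show -((((n : ℝ) - 1) / 2 + ε) / 2) = (-(((n : ℝ) - 1) / 2) - ε) / 2 by ring] at hm
  have hfin : eLpNorm (⇑f) ⊤ volume ≠ ⊤ := (f.memLp ⊤ volume).eLpNorm_ne_top
  have hS : ∀ x, ‖f x‖ ≤ (eLpNorm (⇑f) ⊤ volume).toReal := fun x => by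
    rw [← toReal_enorm]
    exact ENNReal.toReal_mono hfin (f.continuous.enorm_le_eLpNorm_top x)
  rw [eLpNorm_exponent_top]
  refine (eLpNormEssSup_le_of_ae_bound
    (.of_forall (norm_besselD_halfWave_le hm hS))).trans_eq ?_
  rw [ENNReal.ofReal_mul hm.nonneg, ENNReal.ofReal_toReal hfin]
end
end
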